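/- arXiv:0807.4133 — 7 statements merged into one kernel-verified Lean document; each statement's English description precedes it below -/
import Mathlib

section
/- Fix n ∈ ℕ, n ≥ 1. Let x_1,…,x_n be pairwise distinct points of (−1,1) with weights w_1,…,w_n ∈ ℝ such that Σ_{i=1}^n w_i p(x_i) = ∫_{−1}^{1} p(x)dx for every polynomial p of degree at most 2n−1, and let y_1 = −1, y_{n+1} = 1, y_2,…,y_n pairwise distinct points of (−1,1), with weights v_1,…,v_{n+1} ∈ ℝ such that Σ_{i=1}^{n+1} v_i p(y_i) = ∫_{−1}^{1} p(x)dx for every polynomial p of degree at most 2n−1. Then for every (2n−1)-convex function f : [−1,1] → ℝ one has the Hadamard-type inequality Σ_{i=1}^n w_i f(x_i) ≤ ∫_{−1}^{1} f(x)dx ≤ Σ_{i=1}^{n+1} v_i f(y_i). -/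
/-- `f` is `n`-convex on `s ⊆ ℝ`: every divided difference
`[x₁,…,x_{n+2}; f] = ∑ i, f(xᵢ)/∏_{j≠i}(xᵢ-xⱼ)` of `f` at `n+2` pairwise
distinct points of `s` is nonnegative. -/
def NConvexOn (n : ℕ) (s : Set ℝ) (f : ℝ → ℝ) : Prop :=
  ∀ x : Fin (n + 2) → ℝ, Function.Injective x → (∀ i, x i ∈ s) →
    0 ≤ ∑ i, f (x i) / ∏ j ∈ Finset.univ.erase i, (x i - x j)

/-- Divided difference of `f` at the points of a finite set. -/
noncomputable def finsetDividedDifference (T : Finset ℝ) (f : ℝ → ℝ) : ℝ :=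
  ∑ z ∈ T, f z / ∏ u ∈ T.erase z, (z - u)

/-- All divided differences of `f` at `m` distinct points of `s` are nonnegative. -/
def DividedDifferenceNonneg (m : ℕ) (s : Set ℝ) (f : ℝ → ℝ) : Prop :=
  ∀ T : Finset ℝ, T.card = m → (T : Set ℝ) ⊆ s → 0 ≤ finsetDividedDifference T f

theorem NConvexOn.dividedDifferenceNonneg {N : ℕ} {s : Set ℝ} {f : ℝ → ℝ}
    (hf : NConvexOn N s f) : DividedDifferenceNonneg (N + 2) s f := by
  intro T hT hTs
  let e := T.orderEmbOfFin hT
  have himg : Finset.univ.image e = T := Finset.image_orderEmbOfFin_univ T hT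
  have h := hf e e.injective (fun i => hTs (Finset.orderEmbOfFin_mem T hT i))
  have key : finsetDividedDifference T f =
      ∑ i, f (e i) / ∏ j ∈ Finset.univ.erase i, (e i - e j) := by
    unfold finsetDividedDifference
    conv_lhs => rw [← himg]
    rw [Finset.sum_image e.injective.injOn]
    refine Finset.sum_congr rfl fun i _ => ?_
    rw [← Finset.image_erase e.injective, Finset.prod_image e.injective.injOn]
  rw [key]
  exact h

theorem finsetDividedDifference_insert {T : Finset ℝ} (hT : T.Nonempty) {c : ℝ} (hc : c ∉ T)
    (f : ℝ → ℝ) :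
    finsetDividedDifference (insert c T) f =
      finsetDividedDifference T (fun t => (f t - f c) / (t - c)) := by
  have hne : ∀ z ∈ T, z - c ≠ 0 := fun z hz h => hc (by rwa [← sub_eq_zero.mp h])
  have hP : ∏ u ∈ T, (c - u) ≠ 0 :=
    Finset.prod_ne_zero_iff.mpr fun u hu h => hne u hu (by linarith)
  have hbasis : ∑ z ∈ T, ∏ u ∈ T.erase z, ((z - u)⁻¹ * (c - u)) = 1 := by
    have h := congrArg (Polynomial.eval c)
      (Lagrange.sum_basis (F := ℝ) (s := T) (v := id) Function.injective_id.injOn hT)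
    simpa [Polynomial.eval_finsetSum, Lagrange.basis, Lagrange.basisDivisor,
      Polynomial.eval_prod] using h
  have hinv : ∑ z ∈ T, 1 / ((z - c) * ∏ u ∈ T.erase z, (z - u)) = -(1 / ∏ u ∈ T, (c - u)) := by
    rw [← neg_eq_iff_eq_neg, eq_div_iff hP, ← Finset.sum_neg_distrib, Finset.sum_mul]
    refine Eq.trans ?_ hbasis
    refine Finset.sum_congr rfl fun z hz => ?_
    rw [Finset.prod_mul_distrib, Finset.prod_inv_distrib, ← Finset.mul_prod_erase T _ hz]
    have hQ : ∏ u ∈ T.erase z, (z - u) ≠ 0 := Finset.prod_ne_zero_iff.mpr fun u hu h =>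
      (Finset.mem_erase.mp hu).1 (by linarith)
    have := hne z hz
    field_simp
    ring
  unfold finsetDividedDifference
  rw [Finset.sum_insert hc, Finset.erase_insert hc]
  have hsum : ∀ z ∈ T, f z / ∏ u ∈ (insert c T).erase z, (z - u) =
      (f z - f c) / (z - c) / ∏ u ∈ T.erase z, (z - u) +
        f c * (1 / ((z - c) * ∏ u ∈ T.erase z, (z - u))) := by
    intro z hz
    have hzc : c ≠ z := fun h => hc (h ▸ hz)
    rw [Finset.erase_insert_of_ne hzc, Finset.prod_insert fun h => hc (Finset.mem_of_mem_erase h),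
      div_div, mul_one_div, ← add_div]
    ring
  rw [Finset.sum_congr rfl hsum, Finset.sum_add_distrib, ← Finset.mul_sum, hinv]
  ring

theorem DividedDifferenceNonneg.slope {m : ℕ} (hm : 1 ≤ m) {s : Set ℝ} {f : ℝ → ℝ}
    (hf : DividedDifferenceNonneg (m + 1) s f) {c : ℝ} (hc : c ∈ s) :
    DividedDifferenceNonneg m (s \ {c}) (fun t => (f t - f c) / (t - c)) := by
  intro T hT hTs
  have hcT : c ∉ T := fun h => (hTs h).2 rfl
  rw [← finsetDividedDifference_insert (Finset.card_pos.mp (by omega)) hcT]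
  refine hf _ (by rw [Finset.card_insert_of_notMem hcT, hT]) ?_
  rw [Finset.coe_insert, Set.insert_subset_iff]
  exact ⟨hc, fun t ht => (hTs ht).1⟩

theorem DividedDifferenceNonneg.nonneg {s : Set ℝ} {f : ℝ → ℝ}
    (hf : DividedDifferenceNonneg 1 s f) {t : ℝ} (ht : t ∈ s) : 0 ≤ f t := by
  simpa [finsetDividedDifference] using hf {t} (by simp) (by simpa using ht)

theorem DividedDifferenceNonneg.monotoneOn {s : Set ℝ} {f : ℝ → ℝ}
    (hf : DividedDifferenceNonneg 2 s f) : MonotoneOn f s := by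
  intro a ha b hb hab
  rcases hab.eq_or_lt with rfl | hlt
  · rfl
  have h := (hf.slope le_rfl ha).nonneg (t := b) ⟨hb, hlt.ne'⟩
  have h' := mul_nonneg h (sub_pos.mpr hlt).le
  rw [div_mul_cancel₀ _ (sub_pos.mpr hlt).ne'] at h'
  linarith

theorem exists_mem_Ioo_notMem_finset (F : Finset ℝ) {a b : ℝ} (hab : a < b) :
    ∃ c ∈ Set.Ioo a b, c ∉ F := by
  obtain ⟨c, hc, hcF⟩ := (Set.Ioo_infinite hab).exists_notMem_finset F
  exact ⟨c, hc, hcF⟩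

theorem DividedDifferenceNonneg.exists_abs_le {m : ℕ} {F : Finset ℝ} {f : ℝ → ℝ}
    (hf : DividedDifferenceNonneg (m + 2) (Set.Icc (-1) 1 \ F) f) {a b : ℝ}
    (ha : -1 < a) (hb : b < 1) :
    ∃ M, ∀ t ∈ Set.Icc a b, t ∉ F → |f t| ≤ M := by
  rcases lt_or_ge b a with hba | hab
  · exact ⟨0, fun t ht => absurd (ht.1.trans ht.2) hba.not_ge⟩
  induction m generalizing F f with
  | zero =>
    obtain ⟨l, hl, hlF⟩ := exists_mem_Ioo_notMem_finset F ha
    obtain ⟨r, hr, hrF⟩ := exists_mem_Ioo_notMem_finset F hb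
    have hls : l ∈ Set.Icc (-1 : ℝ) 1 \ F := ⟨⟨hl.1.le, by linarith [hl.2]⟩, hlF⟩
    have hrs : r ∈ Set.Icc (-1 : ℝ) 1 \ F := ⟨⟨by linarith [hr.1], hr.2.le⟩, hrF⟩
    refine ⟨max |f l| |f r|, fun t ht htF => ?_⟩
    have hts : t ∈ Set.Icc (-1 : ℝ) 1 \ F := ⟨⟨by linarith [ht.1], by linarith [ht.2]⟩, htF⟩
    exact abs_le_max_abs_abs (hf.monotoneOn hls hts (by linarith [ht.1, hl.2]))
      (hf.monotoneOn hts hrs (by linarith [ht.2, hr.1]))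
  | succ m ih =>
    obtain ⟨c, hc, hcF⟩ := exists_mem_Ioo_notMem_finset F ha
    have hcs : c ∈ Set.Icc (-1 : ℝ) 1 \ F := ⟨⟨hc.1.le, by linarith [hc.2]⟩, hcF⟩
    have hg := hf.slope (by omega) hcs
    have hset : (Set.Icc (-1 : ℝ) 1 \ F) \ {c} = Set.Icc (-1 : ℝ) 1 \ ↑(insert c F) := by
      ext t; simp; tauto
    rw [hset] at hg
    obtain ⟨M, hM⟩ := ih hg
    refine ⟨|f c| + M * 2, fun t ht htF => ?_⟩
    have htc : 0 < t - c := by linarith [ht.1, hc.2]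
    have hMt := hM t ht (by simp [htF, (sub_pos.mp htc).ne'])
    have hft : f t = f c + (f t - f c) / (t - c) * (t - c) := by field_simp; ring
    rw [hft]
    refine (abs_add_le _ _).trans (add_le_add le_rfl ?_)
    rw [abs_mul]
    refine mul_le_mul hMt ?_ (abs_nonneg _) ((abs_nonneg _).trans hMt)
    rw [abs_of_pos htc]
    linarith [ht.2, hc.1]

theorem DividedDifferenceNonneg.exists_abs_slope_le {m : ℕ} {F : Finset ℝ} {f : ℝ → ℝ}
    (hf : DividedDifferenceNonneg (m + 3) (Set.Icc (-1) 1 \ F) f) {x a b : ℝ}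
    (hx : x ∈ Set.Icc (-1 : ℝ) 1 \ F) (ha : -1 < a) (hb : b < 1) :
    ∃ M, ∀ t ∈ Set.Icc a b, t ∉ F → t ≠ x → |(f t - f x) / (t - x)| ≤ M := by
  have hg := hf.slope (by omega) hx
  have hset : (Set.Icc (-1 : ℝ) 1 \ F) \ {x} = Set.Icc (-1 : ℝ) 1 \ ↑(insert x F) := by
    ext t; simp; tauto
  rw [hset] at hg
  obtain ⟨M, hM⟩ := hg.exists_abs_le ha hb
  exact ⟨M, fun t ht htF htx => hM t ht (by simp [htF, htx])⟩

theorem DividedDifferenceNonneg.continuousOn {m : ℕ} {f : ℝ → ℝ}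
    (hf : DividedDifferenceNonneg (m + 3) (Set.Icc (-1) 1) f) :
    ContinuousOn f (Set.Ioo (-1) 1) := by
  intro x hx
  refine ContinuousAt.continuousWithinAt ?_
  have hf' : DividedDifferenceNonneg (m + 3) (Set.Icc (-1) 1 \ ↑(∅ : Finset ℝ)) f := by
    simpa using hf
  obtain ⟨a, ha, hax⟩ := exists_between hx.1
  obtain ⟨b, hxb, hb⟩ := exists_between hx.2
  obtain ⟨M, hM⟩ := hf'.exists_abs_slope_le (x := x) ⟨⟨hx.1.le, hx.2.le⟩, by simp⟩ ha hb
  rw [ContinuousAt, tendsto_iff_norm_sub_tendsto_zero]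
  have hlim : Filter.Tendsto (fun t => M * |t - x|) (nhds x) (nhds 0) := by
    have : Continuous fun t => M * |t - x| := by fun_prop
    simpa using this.tendsto x
  refine squeeze_zero' (Filter.Eventually.of_forall fun t => norm_nonneg _) ?_ hlim
  filter_upwards [Icc_mem_nhds hax hxb] with t ht
  by_cases htx : t = x
  · simp [htx]
  have h := hM t ht (by simp) htx
  rwa [abs_div, div_le_iff₀ (abs_pos.mpr (sub_ne_zero.mpr htx))] at h

/-- Dividing out a double node: the second order slope of `f` at an interior point `x`, taken with
respect to a suitable one-sided limit `d` of the slopes, inherits nonnegativity. -/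
theorem DividedDifferenceNonneg.exists_double_slope {m : ℕ} {F : Finset ℝ} {f : ℝ → ℝ}
    (hf : DividedDifferenceNonneg (m + 3) (Set.Icc (-1) 1 \ F) f) {x : ℝ}
    (hx : x ∈ Set.Ioo (-1 : ℝ) 1) (hxF : x ∉ F) :
    ∃ d, DividedDifferenceNonneg (m + 1) (Set.Icc (-1) 1 \ ↑(insert x F))
      (fun t => ((f t - f x) / (t - x) - d) / (t - x)) := by
  have hxs : x ∈ Set.Icc (-1 : ℝ) 1 \ F := ⟨⟨hx.1.le, hx.2.le⟩, hxF⟩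
  obtain ⟨b, hxb, hb⟩ := exists_between hx.2
  obtain ⟨M, hM⟩ := hf.exists_abs_slope_le hxs hx.1 hb
  obtain ⟨u, -, hu_gt, hu_lim⟩ := exists_seq_strictAnti_tendsto x
  have hev : ∀ G : Finset ℝ, x ∉ G → ∀ᶠ k in Filter.atTop, u k ∈ Set.Icc x b ∧ u k ∉ G := by
    intro G hG
    filter_upwards [hu_lim.eventually (G.finite_toSet.isClosed.isOpen_compl.mem_nhds hG),
      hu_lim.eventually (Iio_mem_nhds hxb)] with k hkG hkb
    exact ⟨⟨(hu_gt k).le, le_of_lt hkb⟩, hkG⟩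
  obtain ⟨d, -, φ, hφ, hd⟩ := tendsto_subseq_of_frequently_bounded
    (x := fun k => (f (u k) - f x) / (u k - x)) (Metric.isBounded_Icc (-M) M)
    (((hev F hxF).mono fun k hk => abs_le.mp (hM _ hk.1 hk.2 (hu_gt k).ne')).frequently)
  refine ⟨d, fun T hT hTs => ?_⟩
  have hxT : x ∉ T := fun h => (hTs h).2 (by simp)
  have hlim : Filter.Tendsto (fun k => finsetDividedDifference T (fun t =>
      ((f t - f x) / (t - x) - (f (u (φ k)) - f x) / (u (φ k) - x)) / (t - u (φ k))))
      Filter.atTop (nhds (finsetDividedDifference T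
        (fun t => ((f t - f x) / (t - x) - d) / (t - x)))) := by
    refine tendsto_finsetSum _ fun z hz => Filter.Tendsto.div_const ?_ _
    refine (tendsto_const_nhds.sub hd).div
      (tendsto_const_nhds.sub (hu_lim.comp hφ.tendsto_atTop)) ?_
    exact sub_ne_zero.mpr fun h => hxT (h ▸ hz)
  refine ge_of_tendsto hlim ?_
  filter_upwards [hφ.tendsto_atTop.eventually (hev (F ∪ T) (by simp [hxF, hxT]))] with k hk
  have hkFT : u (φ k) ∉ F ∧ u (φ k) ∉ T := by simpa using hk.2
  refine ((hf.slope (by omega) hxs).slope (by omega) (c := u (φ k)) ?_) T hT ?_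
  · exact ⟨⟨⟨by linarith [hx.1, hk.1.1], by linarith [hk.1.2]⟩, hkFT.1⟩, (hu_gt _).ne'⟩
  · intro t ht
    have h := hTs ht
    simp only [Finset.coe_insert, Set.mem_sdiff, Set.mem_insert_iff, not_or] at h
    exact ⟨⟨⟨h.1, h.2.2⟩, h.2.1⟩, fun htu => hkFT.2 (htu ▸ ht)⟩

theorem degree_linear_add_quadratic_mul_lt {n : ℕ} {l s q : Polynomial ℝ} (hl : l.degree ≤ 1)
    (hs : s.degree ≤ 2) (hq : q.degree < ((2 * n : ℕ) : WithBot ℕ)) :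
    (l + s * q).degree < ((2 * (n + 1) : ℕ) : WithBot ℕ) := by
  refine (Polynomial.degree_add_le _ _).trans_lt (max_lt (hl.trans_lt ?_) ?_)
  · exact_mod_cast (by omega : 1 < 2 * (n + 1))
  · by_cases hq0 : q = 0
    · rw [hq0, mul_zero, Polynomial.degree_zero]
      exact WithBot.bot_lt_coe _
    rw [Polynomial.degree_mul, Polynomial.degree_eq_natDegree hq0] at *
    have hq' : q.natDegree < 2 * n := by exact_mod_cast hq
    calc s.degree + (q.natDegree : WithBot ℕ) ≤ 2 + (q.natDegree : WithBot ℕ) := by gcongr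
      _ < ((2 * (n + 1) : ℕ) : WithBot ℕ) := by
        exact_mod_cast (by omega : 2 + q.natDegree < 2 * (n + 1))

/-- One-sided Hermite interpolation at `n` double interior nodes. -/
theorem DividedDifferenceNonneg.exists_polynomial_le {n : ℕ} {F X : Finset ℝ} {f : ℝ → ℝ}
    (hf : DividedDifferenceNonneg (2 * n + 1) (Set.Icc (-1) 1 \ F) f) (hXn : X.card = n)
    (hX : ∀ x ∈ X, x ∈ Set.Ioo (-1 : ℝ) 1) (hXF : Disjoint X F) :
    ∃ q : Polynomial ℝ, q.degree < ((2 * n : ℕ) : WithBot ℕ) ∧ (∀ x ∈ X, q.eval x = f x) ∧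
      ∀ t ∈ Set.Icc (-1 : ℝ) 1 \ F, q.eval t ≤ f t := by
  induction n generalizing F X f with
  | zero =>
    obtain rfl := Finset.card_eq_zero.mp hXn
    exact ⟨0, by simp, by simp, fun t ht => by simpa using hf.nonneg ht⟩
  | succ n ih =>
    obtain ⟨x, X', hxX', rfl, hX'⟩ := Finset.card_eq_succ.mp hXn
    rw [Finset.disjoint_insert_left] at hXF
    obtain ⟨d, hd⟩ := DividedDifferenceNonneg.exists_double_slope (m := 2 * n) hf
      (hX x (by simp)) hXF.1
    obtain ⟨q, hq, hqX, hqle⟩ := ih hd hX' (fun z hz => hX z (by simp [hz]))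
      (Finset.disjoint_insert_right.mpr ⟨hxX', hXF.2⟩)
    have hrep : ∀ t, t ≠ x →
        f t = f x + d * (t - x) + (t - x) ^ 2 * (((f t - f x) / (t - x) - d) / (t - x)) := by
      intro t ht
      have := sub_ne_zero.mpr ht
      field_simp
      ring
    refine ⟨Polynomial.C (f x) + Polynomial.C d * (Polynomial.X - Polynomial.C x) +
      (Polynomial.X - Polynomial.C x) ^ 2 * q, ?_, ?_, ?_⟩
    · exact degree_linear_add_quadratic_mul_lt (by compute_degree!) (by compute_degree!) hq
    · intro z hz
      rcases Finset.mem_insert.mp hz with rfl | hz'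
      · simp
      · have hzx : z ≠ x := fun h => hxX' (h ▸ hz')
        rw [hrep z hzx, ← hqX z hz']
        simp
    · intro t ht
      by_cases htx : t = x
      · simp [htx]
      · rw [hrep t htx]
        have h := mul_le_mul_of_nonneg_left (hqle t ⟨ht.1, by simpa [htx] using ht.2⟩)
          (sq_nonneg (t - x))
        simpa using h

/-- Upper interpolation at the two endpoints and at `n` double interior nodes. -/
theorem DividedDifferenceNonneg.exists_polynomial_ge {n : ℕ} {X : Finset ℝ} {f : ℝ → ℝ}
    (hf : DividedDifferenceNonneg (2 * n + 3) (Set.Icc (-1) 1) f) (hXn : X.card = n)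
    (hX : ∀ x ∈ X, x ∈ Set.Ioo (-1 : ℝ) 1) :
    ∃ q : Polynomial ℝ, q.degree < ((2 * (n + 1) : ℕ) : WithBot ℕ) ∧
      q.eval (-1) = f (-1) ∧ q.eval 1 = f 1 ∧ (∀ x ∈ X, q.eval x = f x) ∧
      ∀ t ∈ Set.Icc (-1 : ℝ) 1, f t ≤ q.eval t := by
  have hg := (hf.slope (by omega) (c := -1) (by simp)).slope (by omega) (c := 1) (by norm_num)
  set d := (f 1 - f (-1)) / (1 - -1) with hd
  have hset : (Set.Icc (-1 : ℝ) 1 \ {-1}) \ {1} = Set.Icc (-1 : ℝ) 1 \ ↑({-1, 1} : Finset ℝ) := by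
    ext t
    simp
  rw [hset] at hg
  have hXF : Disjoint X {-1, 1} := by
    rw [Finset.disjoint_left]
    intro z hz hzF
    have := hX z hz
    rcases (by simpa using hzF : z = -1 ∨ z = 1) with rfl | rfl <;> simp at this
  obtain ⟨q, hq, hqX, hqle⟩ := hg.exists_polynomial_le hXn hX hXF
  have hrep : ∀ t, t ≠ -1 → t ≠ 1 → f t = f (-1) + d * (t + 1) +
      (t + 1) * (t - 1) * (((f t - f (-1)) / (t - -1) - d) / (t - 1)) := by
    intro t h1 h2
    have h1' : t + 1 ≠ 0 := fun h => h1 (by linarith)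
    have h2' := sub_ne_zero.mpr h2
    rw [sub_neg_eq_add]
    field_simp
    ring
  have hd2 : f 1 = f (-1) + d * 2 := by rw [hd]; ring
  refine ⟨Polynomial.C (f (-1)) + Polynomial.C d * (Polynomial.X + Polynomial.C 1) +
    (Polynomial.X + Polynomial.C 1) * (Polynomial.X - Polynomial.C 1) * q, ?_, by simp, ?_, ?_, ?_⟩
  · exact degree_linear_add_quadratic_mul_lt (by compute_degree!) (by compute_degree!) hq
  · rw [hd2]
    norm_num [Polynomial.eval_add, Polynomial.eval_mul]
  · intro z hz
    have hz' := hX z hz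
    rw [hrep z hz'.1.ne' hz'.2.ne, ← hqX z hz]
    simp
  · intro t ht
    by_cases h1 : t = -1
    · simp [h1]
    by_cases h2 : t = 1
    · simp [h2, hd2]; linarith
    rw [hrep t h1 h2]
    have h := mul_le_mul_of_nonpos_left (hqle t ⟨ht, by simp [h1, h2]⟩)
      (mul_nonpos_of_nonneg_of_nonpos (by linarith [ht.1] : 0 ≤ t + 1)
        (by linarith [ht.2] : t - 1 ≤ 0))
    simpa using h

theorem intervalIntegrable_of_continuousOn_Ioo_of_bounds {f g h : ℝ → ℝ} {a b : ℝ} (hab : a ≤ b)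
    (hf : ContinuousOn f (Set.Ioo a b)) (hg : Continuous g) (hh : Continuous h)
    (hgf : ∀ t ∈ Set.Icc a b, g t ≤ f t) (hfh : ∀ t ∈ Set.Icc a b, f t ≤ h t) :
    IntervalIntegrable f MeasureTheory.volume a b := by
  rw [intervalIntegrable_iff_integrableOn_Ioo_of_le hab]
  have hbound : MeasureTheory.IntegrableOn (fun t => max |g t| |h t|) (Set.Ioo a b) :=
    ((hg.abs.max hh.abs).continuousOn.integrableOn_Icc).mono_set Set.Ioo_subset_Icc_self
  refine MeasureTheory.Integrable.mono' hbound (hf.aestronglyMeasurable measurableSet_Ioo) ?_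
  refine (MeasureTheory.ae_restrict_iff' measurableSet_Ioo).mpr (Filter.Eventually.of_forall ?_)
  intro t ht
  exact abs_le_max_abs_abs (hgf t (Set.Ioo_subset_Icc_self ht))
    (hfh t (Set.Ioo_subset_Icc_self ht))

/-- Hadamard-type inequality: for a `(2n-1)`-convex function `f` on `[-1,1]`,
`G_n(f) ≤ ∫_{-1}^1 f ≤ Lob_{n+1}(f)` for any Gauss-type rule `(x, w)` and
Lobatto-type rule `(y, v)` exact on `Π_{2n-1}`. -/
theorem gauss_le_integral_le_lobatto
    (n : ℕ) (hn : 1 ≤ n)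
    (x : Fin n → ℝ) (hxinj : Function.Injective x)
    (hx : ∀ i, x i ∈ Set.Ioo (-1 : ℝ) 1) (w : Fin n → ℝ)
    (hG : ∀ p : Polynomial ℝ, p.natDegree ≤ 2 * n - 1 →
      ∑ i, w i * p.eval (x i) = ∫ t in (-1 : ℝ)..1, p.eval t)
    (y : Fin (n + 1) → ℝ) (hyinj : Function.Injective y)
    (hy0 : y 0 = -1) (hyl : y (Fin.last n) = 1)
    (hy : ∀ i, i ≠ 0 → i ≠ Fin.last n → y i ∈ Set.Ioo (-1 : ℝ) 1)
    (v : Fin (n + 1) → ℝ)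
    (hL : ∀ p : Polynomial ℝ, p.natDegree ≤ 2 * n - 1 →
      ∑ i, v i * p.eval (y i) = ∫ t in (-1 : ℝ)..1, p.eval t)
    (f : ℝ → ℝ) (hf : NConvexOn (2 * n - 1) (Set.Icc (-1 : ℝ) 1) f) :
    ∑ i, w i * f (x i) ≤ (∫ t in (-1 : ℝ)..1, f t) ∧
      (∫ t in (-1 : ℝ)..1, f t) ≤ ∑ i, v i * f (y i) := by
  obtain ⟨k, rfl⟩ : ∃ k, n = k + 1 := ⟨n - 1, by omega⟩
  have hdd : DividedDifferenceNonneg (2 * k + 3) (Set.Icc (-1) 1) f := by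
    have h := hf.dividedDifferenceNonneg
    rwa [show 2 * (k + 1) - 1 + 2 = 2 * k + 3 by omega] at h
  have hdd' : DividedDifferenceNonneg (2 * (k + 1) + 1) (Set.Icc (-1) 1 \ ↑(∅ : Finset ℝ)) f := by
    simpa [mul_add] using hdd
  have hdeg : ∀ q : Polynomial ℝ, q.degree < ((2 * (k + 1) : ℕ) : WithBot ℕ) →
      q.natDegree ≤ 2 * (k + 1) - 1 := by
    intro q hq
    have : q.natDegree < 2 * (k + 1) := by
      rcases eq_or_ne q 0 with rfl | hq0
      · simp
      · exact (Polynomial.natDegree_lt_iff_degree_lt hq0).mpr hq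
    omega
  obtain ⟨p, hp, hpx, hpf⟩ := hdd'.exists_polynomial_le (X := Finset.univ.image x)
    (by simp [Finset.card_image_of_injective _ hxinj]) (by simpa using hx) (by simp)
  have hpf' : ∀ t ∈ Set.Icc (-1 : ℝ) 1, p.eval t ≤ f t := fun t ht => hpf t (by simpa using ht)
  have h0l : (0 : Fin (k + 1 + 1)) ≠ Fin.last (k + 1) := (Fin.last_pos).ne
  obtain ⟨q, hq, hq0, hql, hqy, hfq⟩ := hdd.exists_polynomial_ge
    (X := ((Finset.univ.erase 0).erase (Fin.last (k + 1))).image y)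
    (by
      rw [Finset.card_image_of_injective _ hyinj, Finset.card_erase_of_mem (by simp [h0l.symm]),
        Finset.card_erase_of_mem (by simp)]
      simp)
    (by
      intro z hz
      obtain ⟨i, hi, rfl⟩ := Finset.mem_image.mp hz
      simp only [Finset.mem_erase, Finset.mem_univ, and_true] at hi
      exact hy i hi.2 hi.1)
  have hqi : ∀ i, q.eval (y i) = f (y i) := by
    intro i
    by_cases hi0 : i = 0
    · rw [hi0, hy0, hq0]
    by_cases hil : i = Fin.last (k + 1)
    · rw [hil, hyl, hql]
    exact hqy _ (Finset.mem_image_of_mem y (by simp [hi0, hil]))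
  have hint : IntervalIntegrable f MeasureTheory.volume (-1) 1 :=
    intervalIntegrable_of_continuousOn_Ioo_of_bounds (by norm_num) hdd.continuousOn
      p.continuous q.continuous hpf' hfq
  constructor
  · calc ∑ i, w i * f (x i) = ∑ i, w i * p.eval (x i) :=
          Finset.sum_congr rfl fun i _ => by rw [hpx _ (by simp)]
      _ = ∫ t in (-1 : ℝ)..1, p.eval t := hG p (hdeg p hp)
      _ ≤ ∫ t in (-1 : ℝ)..1, f t := intervalIntegral.integral_mono_on (by norm_num)
          (p.continuous.intervalIntegrable _ _) hint hpf'
  · calc ∫ t in (-1 : ℝ)..1, f t ≤ ∫ t in (-1 : ℝ)..1, q.eval t :=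
          intervalIntegral.integral_mono_on (by norm_num) hint
            (q.continuous.intervalIntegrable _ _) hfq
      _ = ∑ i, v i * q.eval (y i) := (hL q (hdeg q hq)).symm
      _ = ∑ i, v i * f (y i) := Finset.sum_congr rfl fun i _ => by rw [hqi]
end

section
/- Fix n, N ∈ ℕ, n ≥ 1, points ξ_1,…,ξ_N ∈ [−1,1] and weights λ_1,…,λ_N ≥ 0, and let T(f) := Σ_{j=1}^N λ_j f(ξ_j) for f : [−1,1] → ℝ. Suppose Σ_{j=1}^N λ_j p(ξ_j) = ∫_{−1}^{1} p(x)dx for every polynomial p of degree at most 2n−1. Let x_1,…,x_n be pairwise distinct points of (−1,1) with weights w_1,…,w_n ∈ ℝ such that Σ_{i=1}^n w_i p(x_i) = ∫_{−1}^{1} p(x)dx for every p of degree at most 2n−1, and let y_1 = −1, y_{n+1} = 1, y_2,…,y_n pairwise distinct points of (−1,1), with weights v_1,…,v_{n+1} ∈ ℝ such that Σ_{i=1}^{n+1} v_i p(y_i) = ∫_{−1}^{1} p(x)dx for every p of degree at most 2n−1. Then for every (2n−1)-convex function f : [−1,1] → ℝ one has Σ_{i=1}^n w_i f(x_i) ≤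 T(f) ≤ Σ_{i=1}^{n+1} v_i f(y_i). -/
open Finset in
/-- Divided differences of an `n`-convex function are nonnegative for points indexed by any
finite type with `n + 2` elements. -/
theorem NConvexOn.sum_div_prod_nonneg {κ : Type*} [Fintype κ] [DecidableEq κ] {n : ℕ}
    {s : Set ℝ} {f : ℝ → ℝ} (hf : NConvexOn n s f) (hκ : Fintype.card κ = n + 2)
    {u : κ → ℝ} (hu : Function.Injective u) (hus : ∀ i, u i ∈ s) :
    0 ≤ ∑ i, f (u i) / ∏ j ∈ univ.erase i, (u i - u j) := by
  let e : Fin (n + 2) ≃ κ := (Fintype.equivFinOfCardEq hκ).symm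
  have h := hf (u ∘ e) (hu.comp e.injective) fun i => hus (e i)
  rw [← Equiv.sum_comp e]
  refine h.trans_eq (sum_congr rfl fun i _ => ?_)
  congr 1
  exact prod_equiv e (by simp) (by simp)

open Finset Polynomial in
/-- Error of Lagrange interpolation of an `n`-convex function at `n + 1` nodes: it is a nonnegative
multiple of the nodal polynomial. -/
theorem NConvexOn.exists_sub_eval_interpolate_eq {ι : Type*} [Fintype ι] [DecidableEq ι] {n : ℕ}
    {s : Set ℝ} {f : ℝ → ℝ} (hf : NConvexOn n s f) (hι : Fintype.card ι = n + 1)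
    {u : ι → ℝ} (hu : Function.Injective u) (hus : ∀ i, u i ∈ s) {t : ℝ} (ht : t ∈ s) :
    ∃ d, 0 ≤ d ∧
      f t - (Lagrange.interpolate univ u (f ∘ u)).eval t = d * ∏ i, (t - u i) := by
  by_cases h : ∃ i, t = u i
  · obtain ⟨i, rfl⟩ := h
    refine ⟨0, le_rfl, ?_⟩
    rw [Lagrange.eval_interpolate_at_node _ hu.injOn (mem_univ i)]
    simp
  · push Not at h
    have hinj : Function.Injective (fun o : Option ι => o.elim t u) := by
      rintro (_ | i) (_ | j) hij
      · rfl
      · exact absurd hij (h j)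
      · exact absurd hij.symm (h i)
      · exact congrArg some (hu hij)
    have hmem : ∀ o : Option ι, o.elim t u ∈ s := by
      rintro (_ | i)
      exacts [ht, hus i]
    have key := hf.sum_div_prod_nonneg (by simp [hι]) hinj hmem
    refine ⟨_, key, ?_⟩
    have hP : ∏ i, (t - u i) ≠ 0 := prod_ne_zero_iff.mpr fun i _ => sub_ne_zero.mpr (h i)
    have hnone : (univ : Finset (Option ι)).erase none = univ.map Function.Embedding.some := by
      ext (_ | i) <;> simp
    have hsome (i : ι) : (univ : Finset (Option ι)).erase (some i) =
        insert none ((univ.erase i).map Function.Embedding.some) := by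
      ext (_ | j) <;> simp
    rw [Lagrange.eval_interpolate_not_at_node _ fun i _ => h i, Lagrange.eval_nodal,
      Fintype.sum_option, hnone, add_mul, prod_map]
    have hterm (i : ι) : f (u i) / ∏ j ∈ (univ : Finset (Option ι)).erase (some i),
        (u i - j.elim t u) =
        -(Lagrange.nodalWeight univ u i * (t - u i)⁻¹ * f (u i)) := by
      rw [hsome, prod_insert (by simp), prod_map, Lagrange.nodalWeight, prod_inv_distrib]
      simp only [Function.Embedding.some_apply, Option.elim_none, Option.elim_some]
      rw [← neg_sub t (u i), neg_mul, div_neg, div_eq_mul_inv, mul_inv]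
      ring
    simp only [Option.elim_none, Option.elim_some, Function.Embedding.some_apply, hterm,
      sum_neg_distrib, Function.comp_apply]
    rw [div_mul_cancel₀ _ hP]
    ring

/-- The Lagrange interpolant at `k + 1` nodes has degree at most `k`. -/
theorem Lagrange.natDegree_interpolate_univ_le {ι : Type*} [Fintype ι] [DecidableEq ι] {k : ℕ}
    (hι : Fintype.card ι = k + 1) {u : ι → ℝ} (hu : Function.Injective u) (r : ι → ℝ) :
    (Lagrange.interpolate Finset.univ u r).natDegree ≤ k := by
  have h := Lagrange.degree_interpolate_lt (s := Finset.univ) r hu.injOn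
  rw [Finset.card_univ, hι] at h
  by_cases h0 : Lagrange.interpolate Finset.univ u r = 0
  · simp [h0]
  · exact Nat.lt_succ_iff.mp ((Polynomial.natDegree_lt_iff_degree_lt h0).mpr h)

open Filter Topology in
/-- A finite set of reals has a positive lower bound on its gaps. -/
theorem Set.Finite.exists_pos_add_lt {F : Set ℝ} (hF : F.Finite) :
    ∃ ε > 0, ∀ a ∈ F, ∀ b ∈ F, a < b → a + ε < b := by
  have h : ∀ᶠ ε in 𝓝[>] (0 : ℝ), ∀ a ∈ F, ∀ b ∈ F, a < b → a + ε < b := by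
    refine (hF.eventually_all).mpr fun a _ => (hF.eventually_all).mpr fun b _ => ?_
    by_cases hab : a < b
    · filter_upwards [Ioo_mem_nhdsGT (sub_pos.mpr hab)] with ε hε _
      linarith [hε.2]
    · exact Eventually.of_forall fun _ h => absurd h hab
  obtain ⟨ε, h, hε⟩ := (h.and self_mem_nhdsWithin).exists
  exact ⟨ε, hε, h⟩

/-- Doubling some nodes by a shift smaller than all gaps keeps the nodes distinct. -/
theorem Function.Injective.sumElim_add {ι κ : Type*} {F : Set ℝ} {ε : ℝ} (hε : 0 < ε)
    (hF : ∀ a ∈ F, ∀ b ∈ F, a < b → a + ε < b) {y : ι → ℝ} (hy : Function.Injective y)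
    (hyF : ∀ i, y i ∈ F) {z : κ → ℝ} (hz : Function.Injective z) (hzF : ∀ i, z i ∈ F) :
    Function.Injective (Sum.elim y fun i => z i + ε) := by
  refine hy.sumElim (fun i j h => hz (add_right_cancel h)) fun i j h => ?_
  have := hF _ (hzF j) _ (hyF i) (by linarith)
  linarith

/-- No point of a set lies strictly between a point of it and its shift by less than all gaps. -/
theorem sub_mul_sub_add_nonneg_of_gap {F : Set ℝ} {ε : ℝ} (hε : 0 < ε)
    (hF : ∀ a ∈ F, ∀ b ∈ F, a < b → a + ε < b) {a t : ℝ} (ha : a ∈ F) (ht : t ∈ F) :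
    0 ≤ (t - a) * (t - (a + ε)) := by
  rcases lt_or_ge a t with h | h
  · exact mul_nonneg (by linarith) (by linarith [hF a ha t ht h])
  · exact mul_nonneg_of_nonpos_of_nonpos (by linarith) (by linarith)

/-- The Gauss rule is a lower bound for positive quadratures of `(2n-1)`-convex functions. -/
theorem gauss_le_quadrature {n N : ℕ} (hn : 1 ≤ n)
    {ξ : Fin N → ℝ} (hξ : ∀ j, ξ j ∈ Set.Icc (-1 : ℝ) 1)
    {lam : Fin N → ℝ} (hlam : ∀ j, 0 ≤ lam j)
    {x : Fin n → ℝ} (hxinj : Function.Injective x)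
    (hx : ∀ i, x i ∈ Set.Ioo (-1 : ℝ) 1) {w : Fin n → ℝ}
    (h : ∀ p : Polynomial ℝ, p.natDegree ≤ 2 * n - 1 →
      ∑ i, w i * p.eval (x i) = ∑ j, lam j * p.eval (ξ j))
    {f : ℝ → ℝ} (hf : NConvexOn (2 * n - 1) (Set.Icc (-1 : ℝ) 1) f) :
    ∑ i, w i * f (x i) ≤ ∑ j, lam j * f (ξ j) := by
  obtain ⟨ε, hε, hF⟩ := (((Set.finite_range x).union (Set.finite_range ξ)).union
    (Set.finite_singleton (1 : ℝ))).exists_pos_add_lt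
  set F := Set.range x ∪ Set.range ξ ∪ {1}
  have hxF (i) : x i ∈ F := Or.inl (Or.inl ⟨i, rfl⟩)
  have hξF (j) : ξ j ∈ F := Or.inl (Or.inr ⟨j, rfl⟩)
  have hu := hxinj.sumElim_add hε hF hxF hxinj hxF
  set u : Fin n ⊕ Fin n → ℝ := Sum.elim x fun i => x i + ε
  have hus : ∀ i, u i ∈ Set.Icc (-1 : ℝ) 1 := by
    rintro (i | i)
    · exact Set.Ioo_subset_Icc_self (hx i)
    · have := hF _ (hxF i) 1 (Or.inr rfl) (hx i).2
      exact ⟨by linarith [(hx i).1, show u (Sum.inr i) = x i + ε from rfl], this.le⟩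
  have hcard : Fintype.card (Fin n ⊕ Fin n) = 2 * n - 1 + 1 := by
    simp only [Fintype.card_sum, Fintype.card_fin]
    omega
  have hp := h _ (Lagrange.natDegree_interpolate_univ_le hcard hu (f ∘ u))
  calc ∑ i, w i * f (x i)
      = ∑ i, w i * (Lagrange.interpolate Finset.univ u (f ∘ u)).eval (x i) := by
        refine Finset.sum_congr rfl fun i _ => ?_
        have := Lagrange.eval_interpolate_at_node (f ∘ u) hu.injOn (Finset.mem_univ (Sum.inl i))
        exact congrArg (w i * ·) this.symm
    _ = _ := hp
    _ ≤ _ := by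
        refine Finset.sum_le_sum fun j _ => mul_le_mul_of_nonneg_left ?_ (hlam j)
        obtain ⟨d, hd, heq⟩ := hf.exists_sub_eval_interpolate_eq hcard hu hus (hξ j)
        have hprod : 0 ≤ ∏ i, (ξ j - u i) := by
          rw [Fintype.prod_sum_type, ← Finset.prod_mul_distrib]
          exact Finset.prod_nonneg fun i _ => sub_mul_sub_add_nonneg_of_gap hε hF (hxF i) (hξF j)
        linarith [mul_nonneg hd hprod]

/-- The Lobatto rule is an upper bound for positive quadratures of `(2n-1)`-convex functions. -/
theorem quadrature_le_lobatto {m N : ℕ}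
    {ξ : Fin N → ℝ} (hξ : ∀ j, ξ j ∈ Set.Icc (-1 : ℝ) 1)
    {lam : Fin N → ℝ} (hlam : ∀ j, 0 ≤ lam j)
    {y : Fin (m + 2) → ℝ} (hyinj : Function.Injective y)
    (hy0 : y 0 = -1) (hyl : y (Fin.last (m + 1)) = 1)
    (hy : ∀ i, i ≠ 0 → i ≠ Fin.last (m + 1) → y i ∈ Set.Ioo (-1 : ℝ) 1)
    {v : Fin (m + 2) → ℝ}
    (h : ∀ p : Polynomial ℝ, p.natDegree ≤ 2 * m + 1 →
      ∑ j, lam j * p.eval (ξ j) = ∑ i, v i * p.eval (y i))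
    {f : ℝ → ℝ} (hf : NConvexOn (2 * m + 1) (Set.Icc (-1 : ℝ) 1) f) :
    ∑ j, lam j * f (ξ j) ≤ ∑ i, v i * f (y i) := by
  obtain ⟨ε, hε, hF⟩ := ((Set.finite_range y).union (Set.finite_range ξ)).exists_pos_add_lt
  set F := Set.range y ∪ Set.range ξ
  have hyF (i) : y i ∈ F := Or.inl ⟨i, rfl⟩
  have hξF (j) : ξ j ∈ F := Or.inr ⟨j, rfl⟩
  have hmid (i : Fin m) : y i.castSucc.succ ∈ Set.Ioo (-1 : ℝ) 1 :=
    hy _ (Fin.succ_ne_zero _) (by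
      rw [← Fin.succ_last]
      exact fun hi => (Fin.castSucc_lt_last i).ne (Fin.succ_injective _ hi))
  have hu := hyinj.sumElim_add hε hF hyF
    (hyinj.comp ((Fin.succ_injective _).comp (Fin.castSucc_injective m)))
    (fun i => hyF i.castSucc.succ)
  simp only [Function.comp_apply] at hu
  set u : Fin (m + 2) ⊕ Fin m → ℝ := Sum.elim y fun i => y i.castSucc.succ + ε
  have hus : ∀ i, u i ∈ Set.Icc (-1 : ℝ) 1 := by
    rintro (i | i)
    · change y i ∈ _
      by_cases h0 : i = 0
      · rw [h0, hy0]; norm_num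
      by_cases hl : i = Fin.last (m + 1)
      · rw [hl, hyl]; norm_num
      exact Set.Ioo_subset_Icc_self (hy i h0 hl)
    · have := hF _ (hyF i.castSucc.succ) _ (hyF (Fin.last _)) (by rw [hyl]; exact (hmid i).2)
      rw [hyl] at this
      exact ⟨by linarith [(hmid i).1, show u (Sum.inr i) = y i.castSucc.succ + ε from rfl],
        this.le⟩
  have hcard : Fintype.card (Fin (m + 2) ⊕ Fin m) = 2 * m + 1 + 1 := by
    simp only [Fintype.card_sum, Fintype.card_fin]
    omega
  have hp := h _ (Lagrange.natDegree_interpolate_univ_le hcard hu (f ∘ u))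
  calc ∑ j, lam j * f (ξ j)
      ≤ ∑ j, lam j * (Lagrange.interpolate Finset.univ u (f ∘ u)).eval (ξ j) := by
        refine Finset.sum_le_sum fun j _ => mul_le_mul_of_nonneg_left ?_ (hlam j)
        obtain ⟨d, hd, heq⟩ := hf.exists_sub_eval_interpolate_eq hcard hu hus (hξ j)
        have hprod : ∏ i, (ξ j - u i) ≤ 0 := by
          have hsplit : ∏ i, (ξ j - u i) = ((ξ j + 1) * (ξ j - 1)) *
              ∏ i : Fin m, ((ξ j - y i.castSucc.succ) * (ξ j - (y i.castSucc.succ + ε))) := by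
            rw [Fintype.prod_sum_type, Finset.prod_mul_distrib, Fin.prod_univ_succ,
              Fin.prod_univ_castSucc]
            simp only [u, Sum.elim_inl, Sum.elim_inr, Fin.succ_last, hy0, hyl]
            ring
          rw [hsplit]
          refine mul_nonpos_of_nonpos_of_nonneg
            (mul_nonpos_of_nonneg_of_nonpos (by linarith [(hξ j).1]) (by linarith [(hξ j).2]))
            (Finset.prod_nonneg fun i _ => sub_mul_sub_add_nonneg_of_gap hε hF (hyF _) (hξF j))
        linarith [mul_nonpos_of_nonneg_of_nonpos hd hprod]
    _ = _ := hp
    _ = _ := by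
        refine Finset.sum_congr rfl fun i _ => ?_
        have := Lagrange.eval_interpolate_at_node (f ∘ u) hu.injOn (Finset.mem_univ (Sum.inl i))
        exact congrArg (v i * ·) this

/-- Extremality for quadrature operators: if `T(f) = ∑ λⱼ f(ξⱼ)` has nonnegative
weights, nodes in `[-1,1]`, and is exact on `Π_{2n-1}`, then for every
`(2n-1)`-convex `f` one has `G_n(f) ≤ T(f) ≤ Lob_{n+1}(f)` for any Gauss-type
and Lobatto-type rules exact on `Π_{2n-1}`. -/
theorem gauss_le_quadrature_le_lobatto
    (n N : ℕ) (hn : 1 ≤ n)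
    (ξ : Fin N → ℝ) (hξ : ∀ j, ξ j ∈ Set.Icc (-1 : ℝ) 1)
    (lam : Fin N → ℝ) (hlam : ∀ j, 0 ≤ lam j)
    (hT : ∀ p : Polynomial ℝ, p.natDegree ≤ 2 * n - 1 →
      ∑ j, lam j * p.eval (ξ j) = ∫ t in (-1 : ℝ)..1, p.eval t)
    (x : Fin n → ℝ) (hxinj : Function.Injective x)
    (hx : ∀ i, x i ∈ Set.Ioo (-1 : ℝ) 1) (w : Fin n → ℝ)
    (hG : ∀ p : Polynomial ℝ, p.natDegree ≤ 2 * n - 1 →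
      ∑ i, w i * p.eval (x i) = ∫ t in (-1 : ℝ)..1, p.eval t)
    (y : Fin (n + 1) → ℝ) (hyinj : Function.Injective y)
    (hy0 : y 0 = -1) (hyl : y (Fin.last n) = 1)
    (hy : ∀ i, i ≠ 0 → i ≠ Fin.last n → y i ∈ Set.Ioo (-1 : ℝ) 1)
    (v : Fin (n + 1) → ℝ)
    (hL : ∀ p : Polynomial ℝ, p.natDegree ≤ 2 * n - 1 →
      ∑ i, v i * p.eval (y i) = ∫ t in (-1 : ℝ)..1, p.eval t)
    (f : ℝ → ℝ) (hf : NConvexOn (2 * n - 1) (Set.Icc (-1 : ℝ) 1) f) :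
    ∑ i, w i * f (x i) ≤ ∑ j, lam j * f (ξ j) ∧
      ∑ j, lam j * f (ξ j) ≤ ∑ i, v i * f (y i) := by
  refine ⟨gauss_le_quadrature hn hξ hlam hxinj hx (fun p hp => (hG p hp).trans (hT p hp).symm) hf,
    ?_⟩
  obtain ⟨m, rfl⟩ : ∃ m, n = m + 1 := ⟨n - 1, by omega⟩
  rw [show 2 * (m + 1) - 1 = 2 * m + 1 by omega] at hT hL hf
  exact quadrature_le_lobatto hξ hlam hyinj hy0 hyl hy
    (fun p hp => (hT p hp).trans (hL p hp).symm) hf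
end

section
/- Fix n, N ∈ ℕ, n ≥ 1, points ξ_1,…,ξ_N ∈ [−1,1] and weights λ_1,…,λ_N ≥ 0, and let T(f) := Σ_{j=1}^N λ_j f(ξ_j) for f : [−1,1] → ℝ. Suppose Σ_{j=1}^N λ_j p(ξ_j) = ∫_{−1}^{1} p(x)dx for every polynomial p of degree at most 2n. Let x_1 = −1 and x_2,…,x_{n+1} be pairwise distinct points of (−1,1), with weights w_1,…,w_{n+1} ∈ ℝ such that Σ_{i=1}^{n+1} w_i p(x_i) = ∫_{−1}^{1} p(x)dx for every p of degree at most 2n, and let y_1,…,y_n be pairwise distinct points of (−1,1) and y_{n+1} = 1, with weights v_1,…,v_{n+1} ∈ ℝ such that Σ_{i=1}^{n+1} v_i p(y_i) = ∫_{−1}^{1} p(x)dx for every p of degree at most 2n. Then for every 2n-convex function f : [−1,1] → ℝ one has Σ_{i=1}^{n+1} w_i f(x_i) ≤ T(f) ≤ Σ_{i=1}^{n+1} v_i f(y_i). -/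
/-- The divided differences of an `n`-convex function, indexed by finite sets of nodes. -/
lemma NConvexOn.sum_div_nonneg {n : ℕ} {s : Set ℝ} {f : ℝ → ℝ} (hf : NConvexOn n s f)
    (S : Finset ℝ) (hS : S.card = n + 2) (hSs : ∀ a ∈ S, a ∈ s) :
    0 ≤ ∑ a ∈ S, f a / ∏ b ∈ S.erase a, (a - b) := by
  classical
  set e := (S.equivFinOfCardEq hS).symm
  have he : Function.Injective fun i => (e i : ℝ) := Subtype.val_injective.comp e.injective
  have himg : Finset.univ.image (fun i => (e i : ℝ)) = S := by
    ext a
    simp only [Finset.mem_image, Finset.mem_univ, true_and]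
    constructor
    · rintro ⟨i, rfl⟩
      exact (e i).2
    · intro ha
      exact ⟨e.symm ⟨a, ha⟩, by simp⟩
  have key := hf (fun i => (e i : ℝ)) he fun i => hSs _ (e i).2
  rw [← himg, Finset.sum_image he.injOn]
  convert key using 3 with i
  rw [← Finset.image_erase he, Finset.prod_image he.injOn]

/-- The error of Lagrange interpolation of an `m`-convex function at `m + 1` nodes has the sign
of the nodal polynomial. -/
lemma NConvexOn.interpolation_error_mul_prod_nonneg {m : ℕ} {s : Set ℝ} {f : ℝ → ℝ}
    (hf : NConvexOn m s f) (U : Finset ℝ) (hU : U.card = m + 1) (hUs : ∀ a ∈ U, a ∈ s)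
    (p : Polynomial ℝ) (hp : p.natDegree ≤ m) (hpf : ∀ a ∈ U, p.eval a = f a)
    {t : ℝ} (ht : t ∈ s) :
    0 ≤ (f t - p.eval t) * ∏ a ∈ U, (t - a) := by
  classical
  by_cases htU : t ∈ U
  · simp [hpf t htU]
  have hcard : (insert t U).card = m + 2 := by rw [Finset.card_insert_of_notMem htU, hU]
  have hdd := hf.sum_div_nonneg (insert t U) hcard (by
    intro a ha
    rcases Finset.mem_insert.mp ha with rfl | ha
    exacts [ht, hUs a ha])
  have hpdd := Lagrange.coeff_eq_sum (s := insert t U) (v := id) Function.injective_id.injOn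
    (P := p) (by
      rw [hcard]
      exact Polynomial.degree_le_natDegree.trans_lt (by exact_mod_cast (by omega)))
  rw [hcard, Polynomial.coeff_eq_zero_of_natDegree_lt (by omega)] at hpdd
  simp only [id] at hpdd
  have hsub : 0 ≤ ∑ a ∈ insert t U, (f a - p.eval a) / ∏ b ∈ (insert t U).erase a, (a - b) := by
    simp only [sub_div, Finset.sum_sub_distrib]
    linarith
  rw [Finset.sum_insert htU, Finset.erase_insert htU,
    Finset.sum_eq_zero fun a ha => by rw [hpf a ha, sub_self, zero_div], add_zero] at hsub
  set Q := ∏ a ∈ U, (t - a) with hQ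
  have hQ0 : Q ≠ 0 :=
    Finset.prod_ne_zero_iff.mpr fun a ha => sub_ne_zero.mpr fun h => htU (h ▸ ha)
  have : (f t - p.eval t) * Q = (f t - p.eval t) / Q * Q ^ 2 := by field_simp
  rw [this]
  positivity

/-- A `2n`-convex function is interpolated at a simple node `x k` and `n` further nodes `x i < 1`
by a polynomial of degree at most `2n` which, at prescribed points, lies below the function to the
right of `x k` and above it to the left. Each node `x i` with `i ≠ k` is doubled by a nearby node,
so that no prescribed point separates the two. -/
lemma NConvexOn.exists_interpolant {n N : ℕ} {f : ℝ → ℝ}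
    (hf : NConvexOn (2 * n) (Set.Icc (-1 : ℝ) 1) f)
    (ξ : Fin N → ℝ) (hξ : ∀ j, ξ j ∈ Set.Icc (-1 : ℝ) 1)
    (x : Fin (n + 1) → ℝ) (hxinj : Function.Injective x) (k : Fin (n + 1))
    (hxk : x k ∈ Set.Icc (-1 : ℝ) 1) (hx : ∀ i, i ≠ k → x i ∈ Set.Ioo (-1 : ℝ) 1) :
    ∃ p : Polynomial ℝ, p.natDegree ≤ 2 * n ∧ (∀ i, p.eval (x i) = f (x i)) ∧
      ∀ j, 0 ≤ (f (ξ j) - p.eval (ξ j)) * (ξ j - x k) := by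
  classical
  obtain ⟨h, hh0, hh1, hhx, hhξ⟩ : ∃ h : ℝ, 0 < h ∧ (∀ i, x i < 1 → x i + h < 1) ∧
      (∀ i j, x i < x j → x i + h < x j) ∧ (∀ i j, x i < ξ j → x i + h < ξ j) := by
    have small : ∀ a b : ℝ, ∀ᶠ h in nhdsWithin (0 : ℝ) (Set.Ioi 0), a < b → a + h < b := by
      intro a b
      by_cases hab : a < b
      · filter_upwards [Ioo_mem_nhdsGT (sub_pos.mpr hab)] with h hh _
        linarith [hh.2]
      · exact Filter.Eventually.of_forall fun h h' => absurd h' hab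
    have hpos : ∀ᶠ h in nhdsWithin (0 : ℝ) (Set.Ioi 0), 0 < h := self_mem_nhdsWithin
    exact (hpos.and ((Filter.eventually_all.mpr fun i => small (x i) 1).and
      ((Filter.eventually_all.mpr fun i => Filter.eventually_all.mpr fun j =>
        small (x i) (x j)).and (Filter.eventually_all.mpr fun i =>
          Filter.eventually_all.mpr fun j => small (x i) (ξ j))))).exists
  set x' : Fin (n + 1) → ℝ := fun i => x i + h with hx'
  have hx'inj : Function.Injective x' := fun i j hij => hxinj (add_right_cancel hij)
  set A := Finset.univ.image x
  set B := (Finset.univ.erase k).image x'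
  have hdisj : Disjoint A B := by
    rw [Finset.disjoint_left]
    intro a ha hb
    obtain ⟨j, -, rfl⟩ := Finset.mem_image.mp ha
    obtain ⟨i, -, hi⟩ := Finset.mem_image.mp hb
    have hi' : x i + h = x j := hi
    linarith [hhx i j (by linarith)]
  have hcard : (A ∪ B).card = 2 * n + 1 := by
    rw [Finset.card_union_of_disjoint hdisj, Finset.card_image_of_injective _ hxinj,
      Finset.card_image_of_injective _ hx'inj, Finset.card_erase_of_mem (Finset.mem_univ k)]
    simp
    omega
  have hmem : ∀ a ∈ A ∪ B, a ∈ Set.Icc (-1 : ℝ) 1 := by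
    intro a ha
    rcases Finset.mem_union.mp ha with ha | ha
    · obtain ⟨i, -, rfl⟩ := Finset.mem_image.mp ha
      by_cases hik : i = k
      · exact hik ▸ hxk
      · exact Set.Ioo_subset_Icc_self (hx i hik)
    · obtain ⟨i, hi, rfl⟩ := Finset.mem_image.mp ha
      have hxi := hx i (Finset.ne_of_mem_erase hi)
      exact ⟨by simp only [hx']; linarith [hxi.1], (hh1 i hxi.2).le⟩
  set p := Lagrange.interpolate (A ∪ B) id f
  have hpf : ∀ a ∈ A ∪ B, p.eval a = f a := fun a ha =>
    Lagrange.eval_interpolate_at_node f (v := id) Function.injective_id.injOn ha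
  have hpdeg : p.natDegree ≤ 2 * n := by
    have := Lagrange.degree_interpolate_le (s := A ∪ B) (v := id) f Function.injective_id.injOn
    rw [hcard] at this
    exact Polynomial.natDegree_le_of_degree_le this
  refine ⟨p, hpdeg, fun i => hpf _ (Finset.mem_union_left _
    (Finset.mem_image_of_mem x (Finset.mem_univ i))), fun j => ?_⟩
  by_cases hj : ξ j ∈ A ∪ B
  · simp [hpf _ hj]
  have key := hf.interpolation_error_mul_prod_nonneg (A ∪ B) hcard hmem p hpdeg hpf (hξ j)
  rw [Finset.prod_union hdisj, Finset.prod_image hxinj.injOn, Finset.prod_image hx'inj.injOn,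
    ← Finset.mul_prod_erase _ _ (Finset.mem_univ k), mul_assoc, ← Finset.prod_mul_distrib,
    ← mul_assoc] at key
  refine nonneg_of_mul_nonneg_left key (Finset.prod_pos fun i hi => ?_)
  have hne : ξ j ≠ x i := fun h' => hj (Finset.mem_union_left _
    (h' ▸ Finset.mem_image_of_mem x (Finset.mem_univ i)))
  rcases hne.lt_or_gt with hlt | hgt
  · exact mul_pos_of_neg_of_neg (by linarith) (by simp only [hx']; linarith)
  · exact mul_pos (by linarith) (by simp only [hx']; linarith [hhξ i j hgt])

/-- Extremality for quadrature operators: if `T(f) = ∑ λⱼ f(ξⱼ)` has nonnegative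
weights, nodes in `[-1,1]`, and is exact on `Π_{2n}`, then for every `2n`-convex
`f` one has `Rad^l_{n+1}(f) ≤ T(f) ≤ Rad^r_{n+1}(f)` for any left and right
Radau-type rules exact on `Π_{2n}`. -/
theorem radau_left_le_quadrature_le_radau_right
    (n N : ℕ) (hn : 1 ≤ n)
    (ξ : Fin N → ℝ) (hξ : ∀ j, ξ j ∈ Set.Icc (-1 : ℝ) 1)
    (lam : Fin N → ℝ) (hlam : ∀ j, 0 ≤ lam j)
    (hT : ∀ p : Polynomial ℝ, p.natDegree ≤ 2 * n →
      ∑ j, lam j * p.eval (ξ j) = ∫ t in (-1 : ℝ)..1, p.eval t)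
    (x : Fin (n + 1) → ℝ) (hxinj : Function.Injective x)
    (hx0 : x 0 = -1) (hx : ∀ i, i ≠ 0 → x i ∈ Set.Ioo (-1 : ℝ) 1)
    (w : Fin (n + 1) → ℝ)
    (hRl : ∀ p : Polynomial ℝ, p.natDegree ≤ 2 * n →
      ∑ i, w i * p.eval (x i) = ∫ t in (-1 : ℝ)..1, p.eval t)
    (y : Fin (n + 1) → ℝ) (hyinj : Function.Injective y)
    (hyl : y (Fin.last n) = 1)
    (hy : ∀ i, i ≠ Fin.last n → y i ∈ Set.Ioo (-1 : ℝ) 1)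
    (v : Fin (n + 1) → ℝ)
    (hRr : ∀ p : Polynomial ℝ, p.natDegree ≤ 2 * n →
      ∑ i, v i * p.eval (y i) = ∫ t in (-1 : ℝ)..1, p.eval t)
    (f : ℝ → ℝ) (hf : NConvexOn (2 * n) (Set.Icc (-1 : ℝ) 1) f) :
    ∑ i, w i * f (x i) ≤ ∑ j, lam j * f (ξ j) ∧
      ∑ j, lam j * f (ξ j) ≤ ∑ i, v i * f (y i) := by
  constructor
  · obtain ⟨p, hdeg, hpx, hpξ⟩ := hf.exists_interpolant ξ hξ x hxinj 0 (by simp [hx0]) hx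
    have hle : ∀ j, p.eval (ξ j) ≤ f (ξ j) := by
      intro j
      rcases (hξ j).1.eq_or_lt with h | h
      · rw [← h, ← hx0, hpx 0]
      · exact sub_nonneg.mp (nonneg_of_mul_nonneg_left (hpξ j) (by rw [hx0]; linarith))
    calc ∑ i, w i * f (x i) = ∑ j, lam j * p.eval (ξ j) := by
          rw [hT p hdeg, ← hRl p hdeg]
          simp only [hpx]
      _ ≤ ∑ j, lam j * f (ξ j) :=
          Finset.sum_le_sum fun j _ => mul_le_mul_of_nonneg_left (hle j) (hlam j)
  · obtain ⟨p, hdeg, hpy, hpξ⟩ :=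
      hf.exists_interpolant ξ hξ y hyinj (Fin.last n) (by simp [hyl]) hy
    have hle : ∀ j, f (ξ j) ≤ p.eval (ξ j) := by
      intro j
      rcases (hξ j).2.eq_or_lt with h | h
      · rw [h, ← hyl, hpy]
      · have := hpξ j
        rw [hyl] at this
        nlinarith
    calc ∑ j, lam j * f (ξ j) ≤ ∑ j, lam j * p.eval (ξ j) :=
          Finset.sum_le_sum fun j _ => mul_le_mul_of_nonneg_left (hle j) (hlam j)
      _ = ∑ i, v i * f (y i) := by
          rw [hT p hdeg, ← hRr p hdeg]
          simp only [hpy]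
end

section
/- Fix k ∈ ℕ, k ≥ 2, and α > 0. Let K and T be linear functionals defined on a linear space of functions [−1,1] → ℝ containing all k-times continuously differentiable functions and all (k−1)-convex functions, and suppose: (i) I(f) ≤ K(f) + α‖f^{(k)}‖ for all f ∈ C^k([−1,1]); (ii) K(f) ≤ T(f) for every (k−1)-convex function f : [−1,1] → ℝ; (iii) T(p) = I(p) for the monomial p(x) = x^k. Then |I(f) − T(f)| ≤ 2α‖f^{(k)}‖ for every f ∈ C^k([−1,1]). -/
/-- The sup norm `‖g‖ = sup {|g x| : x ∈ [-1,1]}` of `g` on `[-1,1]`. -/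
noncomputable def supNormIcc (g : ℝ → ℝ) : ℝ :=
  sSup ((fun t => |g t|) '' Set.Icc (-1 : ℝ) 1)

open Set Polynomial

/-- Generalized Rolle theorem: a `C^n` function with `n + 1` zeros has an `n`-th derivative which
vanishes somewhere. -/
theorem exists_iteratedDerivWithin_eq_zero {a b : ℝ} (hab : a < b) (n : ℕ) {g : ℝ → ℝ}
    (hg : ContDiffOn ℝ n g (Icc a b)) {z : Fin (n + 1) → ℝ} (hz : StrictMono z)
    (hzI : ∀ i, z i ∈ Icc a b) (hgz : ∀ i, g (z i) = 0) :
    ∃ c ∈ Icc a b, iteratedDerivWithin n g (Icc a b) c = 0 := by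
  induction n generalizing g with
  | zero => exact ⟨z 0, hzI 0, by simpa using hgz 0⟩
  | succ n ih =>
    have hrolle : ∀ i : Fin (n + 1), ∃ w ∈ Ioo (z i.castSucc) (z i.succ),
        derivWithin g (Icc a b) w = 0 := by
      intro i
      have hsub : Icc (z i.castSucc) (z i.succ) ⊆ Icc a b :=
        Icc_subset_Icc (hzI _).1 (hzI _).2
      obtain ⟨w, hw, hw0⟩ := exists_deriv_eq_zero (hz i.castSucc_lt_succ)
        (hg.continuousOn.mono hsub) ((hgz _).trans (hgz _).symm)
      refine ⟨w, hw, ?_⟩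
      rw [derivWithin_of_mem_nhds, hw0]
      exact Icc_mem_nhds ((hzI _).1.trans_lt hw.1) (hw.2.trans_le (hzI _).2)
    choose w hw hw0 using hrolle
    have hg' : ContDiffOn ℝ n (derivWithin g (Icc a b)) (Icc a b) :=
      ((contDiffOn_succ_iff_derivWithin (uniqueDiffOn_Icc hab)).1 (by exact_mod_cast hg)).2.2
    rw [iteratedDerivWithin_succ']
    refine ih hg' (z := w) (Fin.strictMono_iff_lt_succ.2 fun i ↦ ?_) (fun i ↦ ?_) hw0
    · have h₁ := (hw i.castSucc).2
      have h₂ := (hw i.succ).1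
      rw [Fin.succ_castSucc] at h₁
      exact h₁.trans h₂
    · exact ⟨(hzI _).1.trans (hw i).1.le, (hw i).2.le.trans (hzI _).2⟩

theorem iteratedDerivWithin_polynomial_eval {s : Set ℝ} (hs : UniqueDiffOn ℝ s) (n : ℕ)
    (p : ℝ[X]) {x : ℝ} (hx : x ∈ s) :
    iteratedDerivWithin n (fun t ↦ p.eval t) s x = (derivative^[n] p).eval x := by
  induction n generalizing p with
  | zero => simp
  | succ n ih =>
    rw [iteratedDerivWithin_succ', Function.iterate_succ_apply, ← ih]
    exact iteratedDerivWithin_congr (fun y hy ↦ p.derivWithin (hs y hy)) hx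

/-- Mean value theorem for divided differences. -/
theorem exists_iteratedDerivWithin_eq_factorial_mul_sum {a b : ℝ} (hab : a < b) (n : ℕ)
    {g : ℝ → ℝ} (hg : ContDiffOn ℝ n g (Icc a b)) {x : Fin (n + 1) → ℝ}
    (hx : Function.Injective x) (hxI : ∀ i, x i ∈ Icc a b) :
    ∃ c ∈ Icc a b, iteratedDerivWithin n g (Icc a b) c =
      n.factorial * ∑ i, g (x i) / ∏ j ∈ Finset.univ.erase i, (x i - x j) := by
  have hinj : InjOn x (Finset.univ : Finset (Fin (n + 1))) := hx.injOn
  obtain ⟨p, hpdeg, hpx⟩ : ∃ p : ℝ[X], p.degree < (Finset.univ : Finset (Fin (n + 1))).card ∧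
      ∀ i, p.eval (x i) = g (x i) :=
    ⟨_, Lagrange.degree_interpolate_lt _ hinj,
      fun i ↦ Lagrange.eval_interpolate_at_node _ hinj (Finset.mem_univ i)⟩
  have hcard : (Finset.univ.image x).card = n + 1 := by
    simp [Finset.card_image_of_injective _ hx]
  have hz : ∀ i, ∃ j, x j = (Finset.univ.image x).orderEmbOfFin hcard i := fun i ↦ by
    obtain ⟨j, -, hj⟩ := Finset.mem_image.1 (Finset.orderEmbOfFin_mem _ hcard i)
    exact ⟨j, hj⟩
  have hpc : ContDiffOn ℝ n (fun t ↦ p.eval t) (Icc a b) := by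
    simpa using (p.contDiff_aeval (𝕜 := ℝ) n).contDiffOn (s := Icc a b)
  obtain ⟨c, hc, hc0⟩ := exists_iteratedDerivWithin_eq_zero hab n (hg.sub hpc)
    ((Finset.univ.image x).orderEmbOfFin hcard).strictMono
    (fun i ↦ by obtain ⟨j, hj⟩ := hz i; exact hj ▸ hxI j)
    (fun i ↦ by obtain ⟨j, hj⟩ := hz i; rw [← hj]; simp [hpx])
  refine ⟨c, hc, ?_⟩
  have hdiff := iteratedDerivWithin_sub hc (uniqueDiffOn_Icc hab) (hg c hc) (hpc c hc)
  have hc0' := hdiff.symm.trans hc0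
  rw [sub_eq_zero.1 hc0', iteratedDerivWithin_polynomial_eval (uniqueDiffOn_Icc hab) n p hc,
    Lagrange.eval_iterate_derivative_eq_sum hinj hpdeg (by simp)]
  simp [hpx]

theorem nConvexOn_of_iteratedDerivWithin_nonneg {a b : ℝ} (hab : a < b) (n : ℕ) {g : ℝ → ℝ}
    (hg : ContDiffOn ℝ (n + 1 : ℕ) g (Icc a b))
    (hpos : ∀ t ∈ Icc a b, 0 ≤ iteratedDerivWithin (n + 1) g (Icc a b) t) :
    NConvexOn n (Icc a b) g := by
  intro x hx hxI
  obtain ⟨c, hc, h⟩ := exists_iteratedDerivWithin_eq_factorial_mul_sum hab (n + 1) hg hx hxI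
  exact nonneg_of_mul_nonneg_right (h ▸ hpos c hc) (by positivity)

theorem abs_le_supNormIcc {g : ℝ → ℝ} (hg : ContinuousOn g (Icc (-1) 1)) {t : ℝ}
    (ht : t ∈ Icc (-1 : ℝ) 1) : |g t| ≤ supNormIcc g :=
  le_csSup (isCompact_Icc.bddAbove_image hg.abs) (mem_image_of_mem _ ht)

theorem supNormIcc_le {g : ℝ → ℝ} {M : ℝ} (hM : ∀ t ∈ Icc (-1 : ℝ) 1, |g t| ≤ M) :
    supNormIcc g ≤ M :=
  csSup_le ((nonempty_Icc.2 (by norm_num)).image _) (forall_mem_image.2 hM)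

theorem supNormIcc_neg (g : ℝ → ℝ) : supNormIcc (fun t ↦ -g t) = supNormIcc g := by
  simp [supNormIcc]

/-- Lemma: if `I(f) ≤ K(f) + α‖f⁽ᵏ⁾‖` for all `f ∈ C^k([-1,1])`, `K ≤ T` on
`(k-1)`-convex functions, and `T` agrees with `I` on `x ^ k`, then
`|I(f) - T(f)| ≤ 2α‖f⁽ᵏ⁾‖` for all `f ∈ C^k([-1,1])`. -/
theorem abs_integral_sub_le_of_le_on_nconvex
    (k : ℕ) (hk : 2 ≤ k) (α : ℝ) (hα : 0 < α)
    (E : Submodule ℝ (ℝ → ℝ))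
    (hEck : ∀ f : ℝ → ℝ, ContDiffOn ℝ (k : ℕ∞) f (Set.Icc (-1 : ℝ) 1) → f ∈ E)
    (hEconv : ∀ g : ℝ → ℝ, NConvexOn (k - 1) (Set.Icc (-1 : ℝ) 1) g → g ∈ E)
    (K T : E →ₗ[ℝ] ℝ)
    (hi : ∀ f : ℝ → ℝ, ∀ hf : ContDiffOn ℝ (k : ℕ∞) f (Set.Icc (-1 : ℝ) 1),
      (∫ t in (-1 : ℝ)..1, f t) ≤ K ⟨f, hEck f hf⟩ +
        α * supNormIcc (iteratedDerivWithin k f (Set.Icc (-1 : ℝ) 1)))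
    (hii : ∀ g : ℝ → ℝ, ∀ hg : NConvexOn (k - 1) (Set.Icc (-1 : ℝ) 1) g,
      K ⟨g, hEconv g hg⟩ ≤ T ⟨g, hEconv g hg⟩)
    (hmonk : (fun t : ℝ => t ^ k) ∈ E)
    (hiii : T ⟨fun t : ℝ => t ^ k, hmonk⟩ = ∫ t in (-1 : ℝ)..1, t ^ k)
    (f : ℝ → ℝ) (hf : ContDiffOn ℝ (k : ℕ∞) f (Set.Icc (-1 : ℝ) 1)) :
    |(∫ t in (-1 : ℝ)..1, f t) - T ⟨f, hEck f hf⟩| ≤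
      2 * α * supNormIcc (iteratedDerivWithin k f (Set.Icc (-1 : ℝ) 1)) := by
  have hs : UniqueDiffOn ℝ (Icc (-1 : ℝ) 1) := uniqueDiffOn_Icc (by norm_num)
  have upper : ∀ f : ℝ → ℝ, ∀ hf : ContDiffOn ℝ (k : ℕ∞) f (Icc (-1 : ℝ) 1),
      (∫ t in (-1 : ℝ)..1, f t) - T ⟨f, hEck f hf⟩ ≤
        2 * α * supNormIcc (iteratedDerivWithin k f (Icc (-1 : ℝ) 1)) := by
    intro f hf
    set M := supNormIcc (iteratedDerivWithin k f (Icc (-1 : ℝ) 1))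
    have hbound : ∀ t ∈ Icc (-1 : ℝ) 1, |iteratedDerivWithin k f (Icc (-1) 1) t| ≤ M :=
      fun t ht ↦ abs_le_supNormIcc (hf.continuousOn_iteratedDerivWithin le_rfl hs) ht
    set c := M / k.factorial with hc
    have hpow : ContDiffOn ℝ (k : ℕ∞) (fun t : ℝ ↦ c * t ^ k) (Icc (-1) 1) := by fun_prop
    set g : ℝ → ℝ := fun t ↦ c * t ^ k + f t with hgdef
    have hg : ContDiffOn ℝ (k : ℕ∞) g (Icc (-1 : ℝ) 1) := hpow.add hf
    have hderiv : ∀ t ∈ Icc (-1 : ℝ) 1, iteratedDerivWithin k g (Icc (-1) 1) t =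
        M + iteratedDerivWithin k f (Icc (-1) 1) t := by
      intro t ht
      rw [hgdef, iteratedDerivWithin_fun_add ht hs (hpow t ht) (hf t ht),
        iteratedDerivWithin_const_mul_field, iteratedDerivWithin_pow ht hs, hc,
        Nat.descFactorial_self]
      field_simp
      simp
    have hconv : NConvexOn (k - 1) (Icc (-1 : ℝ) 1) g := by
      obtain ⟨n, rfl⟩ : ∃ n, k = n + 1 := ⟨k - 1, by omega⟩
      refine nConvexOn_of_iteratedDerivWithin_nonneg (by norm_num) n hg fun t ht ↦ ?_
      rw [hderiv t ht]
      linarith [neg_abs_le (iteratedDerivWithin (n + 1) f (Icc (-1) 1) t), hbound t ht]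
    have hnorm : supNormIcc (iteratedDerivWithin k g (Icc (-1) 1)) ≤ 2 * M := by
      refine supNormIcc_le fun t ht ↦ ?_
      rw [hderiv t ht, abs_le]
      constructor <;> linarith [abs_le.1 (hbound t ht)]
    have hTg : T ⟨g, hEck g hg⟩ =
        c * (∫ t in (-1 : ℝ)..1, t ^ k) + T ⟨f, hEck f hf⟩ := by
      rw [← hiii, ← smul_eq_mul, ← map_smul, ← map_add]
      rfl
    have hIg : (∫ t in (-1 : ℝ)..1, g t) =
        c * (∫ t in (-1 : ℝ)..1, t ^ k) + ∫ t in (-1 : ℝ)..1, f t := by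
      rw [hgdef, intervalIntegral.integral_add, intervalIntegral.integral_const_mul]
      · exact Continuous.intervalIntegrable (by fun_prop) _ _
      · exact hf.continuousOn.intervalIntegrable_of_Icc (by norm_num)
    have h₁ := hi g hg
    have h₂ : K ⟨g, hEck g hg⟩ ≤ T ⟨g, hEck g hg⟩ := hii g hconv
    have h₃ := mul_le_mul_of_nonneg_left hnorm hα.le
    linarith
  have hneg := upper (fun t ↦ -f t) hf.neg
  have hT : T ⟨fun t ↦ -f t, hEck _ hf.neg⟩ = -T ⟨f, hEck f hf⟩ := by
    rw [← map_neg]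
    rfl
  have hD : iteratedDerivWithin k (fun t ↦ -f t) (Icc (-1 : ℝ) 1) =
      fun t ↦ -iteratedDerivWithin k f (Icc (-1 : ℝ) 1) t :=
    funext fun _ ↦ iteratedDerivWithin_fun_neg f
  rw [hT, hD, supNormIcc_neg, intervalIntegral.integral_neg] at hneg
  rw [abs_le]
  constructor <;> linarith [upper f hf]
end

section
/- For n ∈ ℕ, n ≥ 1, set α_{2n} := 4^{n+1}(n!)^4 / ((2n+1)((2n)!)^3) and α_{2n+1} := 4^{n+1}(n+1)(n!)^4 / (((2n+1)!)^3). Fix k ∈ ℕ, k ≥ 2, and let T be a positive linear functional, defined on a linear space of functions [−1,1] → ℝ containing all k-times continuously differentiable functions and all (k−1)-convex functions, which is exact on Π_k. Then |I(f) − T(f)| ≤ α_k ‖f^{(k)}‖ for every f ∈ C^k([−1,1]). -/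
/-- The error constants: `α_{2n} = 4^{n+1}(n!)⁴ / ((2n+1)((2n)!)³)` and
`α_{2n+1} = 4^{n+1}(n+1)(n!)⁴ / (((2n+1)!)³)`. -/
noncomputable def errConst (k : ℕ) : ℝ :=
  if k % 2 = 0 then
    (4 : ℝ) ^ (k / 2 + 1) * (Nat.factorial (k / 2) : ℝ) ^ 4 /
      (((k : ℝ) + 1) * (Nat.factorial k : ℝ) ^ 3)
  else
    (4 : ℝ) ^ (k / 2 + 1) * ((k / 2 : ℕ) + 1 : ℝ) * (Nat.factorial (k / 2) : ℝ) ^ 4 /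
      (Nat.factorial k : ℝ) ^ 3

open Set Filter Topology Polynomial

/-- Iterated Rolle theorem: a `C^n` function with more than `n` zeros in `[a, b]` has an `n`-th
derivative vanishing somewhere in `[a, b]`. -/
theorem exists_iteratedDerivWithin_eq_zero_s17 {a b : ℝ} (hab : a < b) (n : ℕ) (g : ℝ → ℝ)
    (hg : ContDiffOn ℝ n g (Icc a b)) (s : Finset ℝ) (hs : ↑s ⊆ Icc a b) (hcard : n < s.card)
    (hzero : ∀ x ∈ s, g x = 0) : ∃ ξ ∈ Icc a b, iteratedDerivWithin n g (Icc a b) ξ = 0 := by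
  induction n generalizing g s with
  | zero =>
    obtain ⟨x, hx⟩ := Finset.card_pos.1 hcard
    exact ⟨x, hs hx, by simpa using hzero x hx⟩
  | succ n ih =>
    obtain ⟨m, hm⟩ : ∃ m, s.card = m + 1 := ⟨s.card - 1, by omega⟩
    let y := s.orderEmbOfFin hm
    have hy : ∀ i, y i ∈ s := fun i => s.orderEmbOfFin_mem hm i
    have hrolle : ∀ i : Fin m, ∃ z ∈ Ioo (y i.castSucc) (y i.succ), deriv g z = 0 := by
      intro i
      refine exists_deriv_eq_zero (y.strictMono i.castSucc_lt_succ) ?_ ?_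
      · exact hg.continuousOn.mono (Icc_subset_Icc (hs (hy _)).1 (hs (hy _)).2)
      · rw [hzero _ (hy _), hzero _ (hy _)]
    choose z hz hz0 using hrolle
    have hzmono : StrictMono z := by
      intro i j hij
      have : y i.succ ≤ y j.castSucc := y.monotone (Fin.succ_le_castSucc_iff.2 hij)
      exact (hz i).2.trans_le (this.trans (hz j).1.le)
    have hzmem : ∀ i, z i ∈ Ioo a b := fun i =>
      ⟨(hs (hy _)).1.trans_lt (hz i).1, (hz i).2.trans_le (hs (hy _)).2⟩
    rw [iteratedDerivWithin_succ']
    refine ih (derivWithin g (Icc a b)) ?_ (Finset.univ.image z) ?_ ?_ ?_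
    · exact hg.derivWithin (uniqueDiffOn_Icc hab) (by norm_cast)
    · intro x hx
      obtain ⟨i, -, rfl⟩ := Finset.mem_image.1 (Finset.mem_coe.1 hx)
      exact Ioo_subset_Icc_self (hzmem i)
    · rw [Finset.card_image_of_injective _ hzmono.injective, Finset.card_univ, Fintype.card_fin]
      omega
    · intro x hx
      obtain ⟨i, -, rfl⟩ := Finset.mem_image.1 hx
      rw [derivWithin_of_mem_nhds (Icc_mem_nhds (hzmem i).1 (hzmem i).2), hz0]

theorem Polynomial.contDiffOn_eval (p : ℝ[X]) (n : WithTop ℕ∞) (s : Set ℝ) :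
    ContDiffOn ℝ n (fun x => p.eval x) s := by
  simpa using (p.contDiff_aeval (𝕜 := ℝ) n).contDiffOn (s := s)

theorem Polynomial.iteratedDerivWithin_eval (p : ℝ[X]) (n : ℕ) {s : Set ℝ}
    (hs : UniqueDiffOn ℝ s) {x : ℝ} (hx : x ∈ s) :
    iteratedDerivWithin n (fun x => p.eval x) s x = (derivative^[n] p).eval x := by
  induction n generalizing x with
  | zero => simp
  | succ n ih =>
    rw [iteratedDerivWithin_succ, derivWithin_congr (fun y hy => ih hy) (ih hx),
      Polynomial.derivWithin _ (hs x hx), Function.iterate_succ_apply']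

theorem Polynomial.iterate_derivative_eq_C_of_natDegree_le {p : ℝ[X]} {n : ℕ}
    (hp : p.natDegree ≤ n) : derivative^[n] p = C ((n.factorial : ℝ) * p.coeff n) := by
  have h0 : (derivative^[n] p).natDegree ≤ 0 :=
    (natDegree_iterate_derivative p n).trans (by omega)
  rw [eq_C_of_natDegree_le_zero h0, coeff_iterate_derivative]
  simp [Nat.descFactorial_self]

/-- Remainder formula for Lagrange interpolation at distinct nodes of `[a, b]`. -/
theorem exists_sub_eval_interpolate_eq {a b : ℝ} (hab : a < b) {n : ℕ} {f : ℝ → ℝ}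
    (hf : ContDiffOn ℝ n f (Icc a b)) {y : Fin n → ℝ} (hinj : Function.Injective y)
    (hy : ∀ i, y i ∈ Icc a b) {x : ℝ} (hx : x ∈ Icc a b) :
    ∃ ξ ∈ Icc a b, (n.factorial : ℝ) *
        (f x - (Lagrange.interpolate Finset.univ y (f ∘ y)).eval x) =
      iteratedDerivWithin n f (Icc a b) ξ * ∏ i, (x - y i) := by
  set L := Lagrange.interpolate Finset.univ y (f ∘ y) with hL
  have hLy : ∀ i, L.eval (y i) = f (y i) := fun i =>
    Lagrange.eval_interpolate_at_node _ hinj.injOn (Finset.mem_univ i)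
  by_cases hxy : ∃ i, y i = x
  · obtain ⟨i, rfl⟩ := hxy
    refine ⟨y i, hy i, ?_⟩
    rw [hLy, Finset.prod_eq_zero (Finset.mem_univ i) (sub_self _)]
    simp
  push Not at hxy
  set N := Lagrange.nodal Finset.univ y with hN
  have hNx : N.eval x = ∏ i, (x - y i) := Lagrange.eval_nodal
  have hNx0 : N.eval x ≠ 0 := by
    rw [hNx]
    exact Finset.prod_ne_zero_iff.2 fun i _ => sub_ne_zero.2 (hxy i).symm
  set c := (f x - L.eval x) / N.eval x with hc
  set q : ℝ[X] := L + C c * N with hq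
  have hNdeg : N.natDegree = n := by simp [hN, Lagrange.natDegree_nodal]
  have hLdeg : L.degree < n := by
    have := Lagrange.degree_interpolate_lt (s := Finset.univ) (f ∘ y) hinj.injOn
    rwa [Finset.card_univ, Fintype.card_fin] at this
  have hqdeg : q.natDegree ≤ n :=
    natDegree_add_le_of_degree_le (natDegree_le_of_degree_le hLdeg.le)
      ((natDegree_C_mul_le _ _).trans hNdeg.le)
  have hqcoeff : q.coeff n = c := by
    have h1 : N.coeff n = 1 := by
      have := (Lagrange.nodal_monic (s := Finset.univ) (v := y)).coeff_natDegree
      rwa [← hN, hNdeg] at this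
    rw [hq, coeff_add, coeff_C_mul, h1, coeff_eq_zero_of_degree_lt hLdeg]
    ring
  obtain ⟨ξ, hξ, hξ0⟩ := exists_iteratedDerivWithin_eq_zero_s17 hab n (f - fun t => q.eval t)
    (hf.sub (q.contDiffOn_eval _ _)) (insert x (Finset.univ.image y)) (by
      intro t ht
      rw [Finset.mem_coe, Finset.mem_insert, Finset.mem_image] at ht
      obtain rfl | ⟨i, -, rfl⟩ := ht
      exacts [hx, hy i]) (by
      rw [Finset.card_insert_of_notMem (by simpa using hxy),
        Finset.card_image_of_injective _ hinj]
      simp) (by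
      intro t ht
      rw [Finset.mem_insert, Finset.mem_image] at ht
      obtain rfl | ⟨i, -, rfl⟩ := ht
      · simp only [Pi.sub_apply, hq, eval_add, eval_mul, eval_C, hc]
        field_simp
        ring
      · have : N.eval (y i) = 0 := Lagrange.eval_nodal_at_node (Finset.mem_univ i)
        simp [hq, this, hLy])
  refine ⟨ξ, hξ, ?_⟩
  have hu := uniqueDiffOn_Icc hab
  rw [iteratedDerivWithin_sub hξ hu (hf ξ hξ) (q.contDiffOn_eval _ _ ξ hξ),
    q.iteratedDerivWithin_eval n hu hξ, iterate_derivative_eq_C_of_natDegree_le hqdeg, hqcoeff,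
    eval_C, sub_eq_zero] at hξ0
  rw [hξ0, ← hNx, hc]
  field_simp

/-- Any tuple of points of `[a, b]` is a limit of injective tuples: the product `∏ (t - v i)` is
uniformly approximated by products with distinct nodes. -/
theorem exists_injective_forall_abs_prod_sub_lt {a b : ℝ} (hab : a < b) {n : ℕ} {v : Fin n → ℝ}
    (hv : ∀ i, v i ∈ Icc a b) {δ : ℝ} (hδ : 0 < δ) :
    ∃ y : Fin n → ℝ, Function.Injective y ∧ (∀ i, y i ∈ Icc a b) ∧
      ∀ t ∈ Icc a b, |∏ i, (t - y i) - ∏ i, (t - v i)| < δ := by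
  obtain ⟨c, hcinj, hcmem⟩ : ∃ c : Fin n → ℝ, Function.Injective c ∧ ∀ i, c i ∈ Icc a b := by
    have := (Icc_infinite hab).to_subtype
    obtain ⟨e⟩ : Nonempty (ℕ ↪ Icc a b) := ⟨Infinite.natEmbedding _⟩
    exact ⟨fun i => e i, fun i j h => Fin.ext (e.injective (Subtype.ext h)), fun i => (e i).2⟩
  let y : ℝ → Fin n → ℝ := fun r i => v i + r * (c i - v i)
  have hinj : ∀ᶠ r in 𝓝[>] (0 : ℝ), Function.Injective (y r) := by
    have : ∀ i j, ∀ᶠ r in 𝓝[>] (0 : ℝ), y r i = y r j → i = j := by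
      intro i j
      by_cases hij : i = j
      · exact Eventually.of_forall fun _ _ => hij
      by_cases hvij : v i = v j
      · filter_upwards [self_mem_nhdsWithin] with r hr h
        refine hcinj (mul_left_cancel₀ (ne_of_gt hr) ?_)
        simp only [y, hvij] at h
        linarith
      · have hcont : Continuous fun r => y r i - y r j := by fun_prop
        have : ∀ᶠ r in 𝓝 (0 : ℝ), y r i - y r j ≠ 0 :=
          hcont.continuousAt.eventually_ne (by simpa [y, sub_eq_zero] using hvij)
        filter_upwards [nhdsWithin_le_nhds this] with r hr h
        exact absurd (sub_eq_zero.2 h) hr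
    filter_upwards [eventually_all.2 fun i => eventually_all.2 (this i)] with r hr i j
    exact hr i j
  have hclose : ∀ᶠ r in 𝓝[>] (0 : ℝ),
      ∀ t ∈ Icc a b, |∏ i, (t - y r i) - ∏ i, (t - v i)| < δ := by
    refine nhdsWithin_le_nhds (isCompact_Icc.eventually_forall_of_forall_eventually
      fun t _ => ?_)
    have hcont : Continuous fun z : ℝ × ℝ => |∏ i, (z.2 - y z.1 i) - ∏ i, (z.2 - v i)| := by
      fun_prop
    exact hcont.continuousAt.eventually_lt continuousAt_const (by simpa [y] using hδ)
  obtain ⟨r, ⟨h1, h2⟩, hr⟩ :=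
    ((hinj.and hclose).and (Ioo_mem_nhdsGT (zero_lt_one' ℝ))).exists
  refine ⟨y r, h1, fun i => ?_, h2⟩
  have := (convex_Icc a b).add_smul_sub_mem (hv i) (hcmem i) (Ioo_subset_Icc_self hr)
  simpa [y] using this

/-- If the nodal polynomial `∏ (t - v i)` is nonnegative on `[a, b]`,
then `f` is approximated there, up to an arbitrarily small error `ε`, by a polynomial of degree
less than `n` with the error controlled by the nodal polynomial. -/
theorem exists_polynomial_abs_sub_le {a b : ℝ} (hab : a < b) {n : ℕ} {f : ℝ → ℝ}
    (hf : ContDiffOn ℝ n f (Icc a b)) {M : ℝ}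
    (hM : ∀ x ∈ Icc a b, |iteratedDerivWithin n f (Icc a b) x| ≤ M) {v : Fin n → ℝ}
    (hv : ∀ i, v i ∈ Icc a b) (hpos : ∀ t ∈ Icc a b, 0 ≤ ∏ i, (t - v i)) {ε : ℝ} (hε : 0 < ε) :
    ∃ p : ℝ[X], p.natDegree ≤ n ∧
      ∀ t ∈ Icc a b, |f t - p.eval t| ≤ M / n.factorial * ∏ i, (t - v i) + ε := by
  have hM0 : 0 ≤ M := (abs_nonneg _).trans (hM a (left_mem_Icc.2 hab.le))
  have hfac : (0 : ℝ) < n.factorial := by exact_mod_cast n.factorial_pos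
  obtain ⟨y, hinj, hy, hclose⟩ := exists_injective_forall_abs_prod_sub_lt hab hv
    (δ := ε / (M / n.factorial + 1)) (by positivity)
  refine ⟨Lagrange.interpolate Finset.univ y (f ∘ y), ?_, fun t ht => ?_⟩
  · refine natDegree_le_of_degree_le (le_of_lt ?_)
    simpa using Lagrange.degree_interpolate_lt (s := Finset.univ) (f ∘ y) hinj.injOn
  obtain ⟨ξ, hξ, h⟩ := exists_sub_eval_interpolate_eq hab hf hinj hy ht
  set e := f t - (Lagrange.interpolate Finset.univ y (f ∘ y)).eval t
  set δ := ε / (M / n.factorial + 1) with hδ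
  have hA : |∏ i, (t - y i)| ≤ ∏ i, (t - v i) + δ := by
    have h1 := abs_lt.1 (hclose t ht)
    have h2 := hpos t ht
    exact abs_le.2 ⟨by linarith [h1.1], by linarith [h1.2]⟩
  have he : |e| = |iteratedDerivWithin n f (Icc a b) ξ| * |∏ i, (t - y i)| / n.factorial := by
    rw [eq_div_iff hfac.ne', ← abs_mul, ← h, abs_mul, abs_of_pos hfac, mul_comm]
  have hδε : M / n.factorial * δ ≤ ε := by
    rw [hδ, mul_div_assoc', div_le_iff₀ (by positivity)]
    nlinarith
  calc |e| ≤ M * (∏ i, (t - v i) + δ) / n.factorial := by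
        rw [he]
        gcongr
        exact hM ξ hξ
    _ = M / n.factorial * ∏ i, (t - v i) + M / n.factorial * δ := by ring
    _ ≤ _ := by gcongr
/-- If a real polynomial splits with all its roots in `[a, b]`, so does its derivative. -/
theorem Polynomial.splits_derivative_and_roots_subset_Icc {a b : ℝ} {p : ℝ[X]}
    (hp : p.Splits) (hr : ∀ x ∈ p.roots, x ∈ Icc a b) :
    p.derivative.Splits ∧ ∀ x ∈ p.derivative.roots, x ∈ Icc a b := by
  refine ⟨?_, fun x hx => ?_⟩
  · rw [splits_iff_card_roots] at hp ⊢
    have h1 := p.card_roots_le_derivative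
    have h2 := p.derivative.card_roots'
    have h3 := p.natDegree_derivative
    omega
  · have hd : p.derivative ≠ 0 := ne_zero_of_mem_roots hx
    have hx0 : p.derivative.eval x = 0 := isRoot_of_mem_roots hx
    have hp0 : p ≠ 0 := by
      rintro rfl
      simp at hd
    by_cases hpx : p.eval x = 0
    · exact hr x ((mem_roots hp0).2 hpx)
    have hsum := hp.eval_derivative_div_eval_of_ne_zero hpx
    rw [hx0, zero_div] at hsum
    have hdeg : p.natDegree ≠ 0 := fun h => hd (by rw [eq_C_of_natDegree_eq_zero h, derivative_C])
    obtain ⟨z, hz⟩ : ∃ z, z ∈ p.roots := by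
      refine Multiset.exists_mem_of_ne_zero fun h => hdeg ?_
      rw [← splits_iff_card_roots.1 hp, h, Multiset.card_zero]
    constructor
    · by_contra! hxa
      have hneg : ∀ w ∈ p.roots, 0 < 1 / (w - x) := fun w hw =>
        one_div_pos.2 (by linarith [(hr w hw).1])
      have hsum' : (p.roots.map fun w => 1 / (w - x)).sum = 0 := by
        have : (fun w => 1 / (w - x)) = fun w => -(1 / (x - w)) := by
          funext w
          rw [← neg_sub x w, one_div_neg_eq_neg_one_div]
        rw [this, Multiset.sum_map_neg, ← hsum, neg_zero]
      have := Multiset.all_zero_of_le_zero_le_of_sum_eq_zero (by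
        intro t ht
        obtain ⟨w, hw, rfl⟩ := Multiset.mem_map.1 ht
        exact (hneg w hw).le) hsum' _ (Multiset.mem_map_of_mem _ hz)
      exact (hneg z hz).ne' this
    · by_contra! hxb
      have hpos : ∀ w ∈ p.roots, 0 < 1 / (x - w) := fun w hw =>
        one_div_pos.2 (by linarith [(hr w hw).2])
      have := Multiset.all_zero_of_le_zero_le_of_sum_eq_zero (by
        intro t ht
        obtain ⟨w, hw, rfl⟩ := Multiset.mem_map.1 ht
        exact (hpos w hw).le) hsum.symm _ (Multiset.mem_map_of_mem _ hz)
      exact (hpos z hz).ne' this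

theorem Polynomial.splits_iterate_derivative_and_roots_subset_Icc {a b : ℝ} {p : ℝ[X]}
    (hp : p.Splits) (hr : ∀ x ∈ p.roots, x ∈ Icc a b) (n : ℕ) :
    (derivative^[n] p).Splits ∧ ∀ x ∈ (derivative^[n] p).roots, x ∈ Icc a b := by
  induction n with
  | zero => exact ⟨hp, hr⟩
  | succ n ih =>
    rw [Function.iterate_succ_apply']
    exact splits_derivative_and_roots_subset_Icc ih.1 ih.2

/-- Integration by parts for polynomials, without boundary terms. -/
theorem Polynomial.integral_derivative_mul {a b : ℝ} (u q : ℝ[X])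
    (ha : (u * q).eval a = 0) (hb : (u * q).eval b = 0) :
    ∫ t in a..b, (derivative u * q).eval t = -∫ t in a..b, (u * derivative q).eval t := by
  have hint : ∀ p : ℝ[X], IntervalIntegrable (fun t => p.eval t) MeasureTheory.volume a b :=
    fun p => p.continuous.intervalIntegrable _ _
  have h := intervalIntegral.integral_eq_sub_of_hasDerivAt
    (fun t _ => (u * q).hasDerivAt t) (hint _ : IntervalIntegrable _ _ a b)
  rw [ha, hb, derivative_mul] at h
  simp only [eval_add] at h
  rw [intervalIntegral.integral_add (hint _) (hint _)] at h
  linarith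

/-- Iterated integration by parts against a polynomial vanishing to order `n` at the endpoints. -/
theorem Polynomial.integral_iterate_derivative_mul {a b : ℝ} (n : ℕ) (u q : ℝ[X])
    (ha : (X - C a) ^ n ∣ u) (hb : (X - C b) ^ n ∣ u) :
    ∫ t in a..b, (derivative^[n] u * q).eval t =
      (-1) ^ n * ∫ t in a..b, (u * derivative^[n] q).eval t := by
  induction n generalizing q with
  | zero => simp
  | succ n ih =>
    have hroot : ∀ c : ℝ, (X - C c) ^ (n + 1) ∣ u → (derivative^[n] u * q).eval c = 0 := by
      intro c hc
      have := pow_sub_dvd_iterate_derivative_of_pow_dvd n hc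
      rw [Nat.add_sub_cancel_left, pow_one, dvd_iff_isRoot] at this
      rw [eval_mul, this, zero_mul]
    rw [Function.iterate_succ_apply', integral_derivative_mul _ _ (hroot a ha) (hroot b hb),
      ih _ ((pow_dvd_pow _ n.le_succ).trans ha) ((pow_dvd_pow _ n.le_succ).trans hb),
      Function.iterate_succ_apply, pow_succ]
    ring

/-- A beta integral on `[-1, 1]`. -/
theorem integral_sub_one_pow_mul_add_one_pow (n m : ℕ) :
    ∫ t in (-1 : ℝ)..1, ((X - C 1) ^ n * (X - C (-1)) ^ m : ℝ[X]).eval t =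
      (-1) ^ n * 2 ^ (n + m + 1) * n.factorial * m.factorial / (n + m + 1).factorial := by
  induction n generalizing m with
  | zero =>
    have h : ∀ t ∈ uIcc (-1 : ℝ) 1,
        HasDerivAt (fun t : ℝ => (t + 1) ^ (m + 1) / (m + 1)) ((t + 1) ^ m) t := by
      intro t _
      have := (((hasDerivAt_id t).add_const 1).pow (m + 1)).div_const ((m : ℝ) + 1)
      refine this.congr_deriv ?_
      simp
      field_simp
    have := intervalIntegral.integral_eq_sub_of_hasDerivAt h
      (Continuous.intervalIntegrable (by fun_prop) _ _)
    simp only [pow_zero, one_mul, eval_pow, eval_sub, eval_X, eval_C, sub_neg_eq_add, this]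
    rw [zero_add, Nat.factorial_succ]
    push_cast
    field_simp
    norm_num
  | succ n ih =>
    have h := integral_derivative_mul (a := -1) (b := 1) ((X - C (-1)) ^ (m + 1))
      ((X - C 1) ^ (n + 1)) (by simp) (by simp)
    have h1 : derivative ((X - C (-1) : ℝ[X]) ^ (m + 1)) * (X - C 1) ^ (n + 1) =
        C ((m : ℝ) + 1) * ((X - C 1) ^ (n + 1) * (X - C (-1)) ^ m) := by
      rw [derivative_X_sub_C_pow, Nat.add_sub_cancel]
      simp
      ring
    have h2 : (X - C (-1) : ℝ[X]) ^ (m + 1) * derivative ((X - C 1) ^ (n + 1)) =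
        C ((n : ℝ) + 1) * ((X - C 1) ^ n * (X - C (-1)) ^ (m + 1)) := by
      rw [derivative_X_sub_C_pow, Nat.add_sub_cancel]
      simp
      ring
    rw [h1, h2] at h
    simp only [eval_C_mul, intervalIntegral.integral_const_mul, ih] at h
    have hm : (m : ℝ) + 1 ≠ 0 := by positivity
    rw [← mul_right_inj' hm, h, show n + (m + 1) + 1 = n + 1 + m + 1 by ring,
      Nat.factorial_succ n, Nat.factorial_succ m]
    push_cast
    ring

/-- The product of the weight `(1 + t) ^ b` and the square of the monic Jacobi polynomial of degree
`n` for this weight has all its roots in `[-1, 1]`, is nonnegative there, and its integral is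
explicit. For `b = 0` and `b = 1` it is the nodal polynomial of the Gauss and Radau quadratures. -/
theorem exists_nodal_polynomial (n b : ℕ) :
    ∃ W : ℝ[X], W.Monic ∧ W.natDegree = 2 * n + b ∧ W.Splits ∧
      (∀ x ∈ W.roots, x ∈ Icc (-1 : ℝ) 1) ∧ (∀ x ∈ Icc (-1 : ℝ) 1, 0 ≤ W.eval x) ∧
      ∫ t in (-1 : ℝ)..1, W.eval t = 2 ^ (2 * n + b + 1) * (n.factorial : ℝ) ^ 2 *
        ((n + b).factorial : ℝ) ^ 2 / ((2 * n + b).factorial * (2 * n + b + 1).factorial) := by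
  set U : ℝ[X] := (X - C 1) ^ n * (X - C (-1)) ^ (n + b) with hU
  have hUmonic : U.Monic := ((monic_X_sub_C _).pow _).mul ((monic_X_sub_C _).pow _)
  have hUdeg : U.natDegree = 2 * n + b := by
    rw [hU, ((monic_X_sub_C _).pow _).natDegree_mul ((monic_X_sub_C _).pow _),
      natDegree_pow, natDegree_pow, natDegree_X_sub_C, natDegree_X_sub_C]
    ring
  have hUsplits : U.Splits := ((Splits.X_sub_C _).pow _).mul ((Splits.X_sub_C _).pow _)
  have hUroots : ∀ x ∈ U.roots, x ∈ Icc (-1 : ℝ) 1 := by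
    intro x hx
    have := isRoot_of_mem_roots hx
    simp only [hU, IsRoot.def, eval_mul, eval_pow, eval_sub, eval_X, eval_C, mul_eq_zero] at this
    rcases this with h | h
    · have : x = 1 := by linarith [eq_zero_of_pow_eq_zero h]
      subst this
      norm_num
    · have : x = -1 := by linarith [eq_zero_of_pow_eq_zero h]
      subst this
      norm_num
  obtain ⟨hDsplits, hDroots⟩ :=
    splits_iterate_derivative_and_roots_subset_Icc hUsplits hUroots n
  set D := derivative^[n] U with hD
  set d : ℝ := ((2 * n + b).descFactorial n : ℝ) with hd
  have hdfac : ((n + b).factorial : ℝ) * d = (2 * n + b).factorial := by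
    have := Nat.factorial_mul_descFactorial (n := 2 * n + b) (k := n) (by omega)
    rw [show 2 * n + b - n = n + b by omega] at this
    rw [hd]
    exact_mod_cast this
  have hd0 : d ≠ 0 := fun h => by
    rw [h, mul_zero] at hdfac
    exact (Nat.factorial_pos (2 * n + b)).ne (by exact_mod_cast hdfac)
  have hDle : D.natDegree ≤ n + b := by
    have := natDegree_iterate_derivative U n
    rw [← hD] at this
    omega
  have hDcoeff : D.coeff (n + b) = d := by
    rw [hD, coeff_iterate_derivative, show n + b + n = 2 * n + b by ring, ← hUdeg,
      hUmonic.coeff_natDegree, hUdeg, nsmul_eq_mul, mul_one]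
  obtain ⟨R, hR⟩ : (X - C (-1)) ^ b ∣ D := by
    have h := pow_sub_dvd_iterate_derivative_of_pow_dvd n
      (Dvd.intro_left ((X - C 1) ^ n) rfl : (X - C (-1)) ^ (n + b) ∣ U)
    rwa [Nat.add_sub_cancel_left] at h
  set P := C d⁻¹ * R with hP
  have hDP : D = C d * ((X - C (-1)) ^ b * P) := by
    rw [hR, hP]
    calc _ = C (d * d⁻¹) * ((X - C (-1)) ^ b * R) := by rw [mul_inv_cancel₀ hd0]; simp
      _ = _ := by rw [C_mul]; ring
  have hwP : ((X - C (-1)) ^ b * P).Monic := by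
    have h1 : (X - C (-1)) ^ b * P = C d⁻¹ * D := by
      rw [hDP, ← mul_assoc (C d⁻¹), ← C_mul, inv_mul_cancel₀ hd0, C_1, one_mul]
    rw [h1]
    refine monic_of_natDegree_le_of_coeff_eq_one (n + b)
      ((natDegree_C_mul_le _ _).trans hDle) ?_
    rw [coeff_C_mul, hDcoeff, inv_mul_cancel₀ hd0]
  have hw : ((X - C (-1) : ℝ[X]) ^ b).Monic := (monic_X_sub_C _).pow _
  have hPmonic : P.Monic := hw.of_mul_monic_left hwP
  have hPdeg : P.natDegree = n := by
    have h1 : D.natDegree = b + P.natDegree := by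
      rw [hDP, natDegree_C_mul hd0, hw.natDegree_mul hPmonic, natDegree_pow, natDegree_X_sub_C,
        mul_one]
    have h2 : n + b ≤ D.natDegree := le_natDegree_of_ne_zero (by rwa [hDcoeff])
    omega
  have hD0 : D ≠ 0 := fun h => hd0 (by rw [← hDcoeff, h, coeff_zero])
  have hPD : P ∣ D := ⟨C d * (X - C (-1)) ^ b, by rw [hDP]; ring⟩
  have hPsplits : P.Splits := hDsplits.of_dvd hD0 hPD
  have hPP : (P * P).Monic := hPmonic.mul hPmonic
  refine ⟨(X - C (-1)) ^ b * (P * P), hw.mul hPP, ?_, ?_, ?_, ?_, ?_⟩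
  · rw [hw.natDegree_mul hPP, hPmonic.natDegree_mul hPmonic, natDegree_pow, natDegree_X_sub_C,
      hPdeg]
    ring
  · exact ((Splits.X_sub_C _).pow _).mul (hPsplits.mul hPsplits)
  · intro x hx
    refine hDroots x ((mem_roots hD0).2 ?_)
    have := isRoot_of_mem_roots hx
    rw [IsRoot.def, eval_mul, eval_mul, mul_eq_zero, mul_self_eq_zero] at this
    rw [IsRoot.def, hDP, eval_mul, eval_mul]
    rcases this with h | h <;> rw [h] <;> ring
  · intro x hx
    rw [eval_mul, eval_mul, eval_pow, eval_sub, eval_X, eval_C]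
    exact mul_nonneg (pow_nonneg (by linarith [hx.1]) _) (mul_self_nonneg _)
  · have hparts := integral_iterate_derivative_mul (a := -1) (b := 1) n U P
      ((pow_dvd_pow _ (Nat.le_add_right n b)).trans (Dvd.intro_left _ rfl)) (Dvd.intro _ rfl)
    have hPn : P.coeff n = 1 := by
      have := hPmonic.coeff_natDegree
      rwa [hPdeg] at this
    have hW : D * P = C d * ((X - C (-1)) ^ b * (P * P)) := by
      rw [hDP]
      ring
    rw [← hD, hW, iterate_derivative_eq_C_of_natDegree_le hPdeg.le, hPn, mul_one,
      mul_comm U] at hparts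
    simp only [eval_C_mul, intervalIntegral.integral_const_mul] at hparts
    rw [hU, integral_sub_one_pow_mul_add_one_pow, show n + (n + b) + 1 = 2 * n + b + 1 by ring]
      at hparts
    have hsign : ((-1 : ℝ) ^ n) * (-1) ^ n = 1 := by rw [← mul_pow]; simp
    rw [← mul_right_inj' hd0, hparts, ← hdfac]
    have := Nat.factorial_ne_zero (n + b)
    have := Nat.factorial_ne_zero (2 * n + b + 1)
    field_simp
    rw [sq, hsign]

/-- A monic real polynomial that splits is a product of linear factors indexed by `Fin`. -/
theorem Polynomial.exists_eq_prod_X_sub_C {W : ℝ[X]} (hW : W.Monic) (hs : W.Splits) {k : ℕ}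
    (hk : W.natDegree = k) :
    ∃ v : Fin k → ℝ, (∀ i, v i ∈ W.roots) ∧ ∀ t, W.eval t = ∏ i, (t - v i) := by
  have hlen : W.roots.toList.length = k := by
    rw [Multiset.length_toList, splits_iff_card_roots.1 hs, hk]
  subst hlen
  refine ⟨W.roots.toList.get, fun i => Multiset.mem_toList.1 (List.get_mem _ _), fun t => ?_⟩
  rw [hs.eval_eq_prod_roots_of_monic hW]
  conv_lhs => rw [← Multiset.coe_toList W.roots]
  rw [Multiset.map_coe, Multiset.prod_coe, ← List.prod_ofFn]
  conv_lhs => rw [← List.ofFn_get W.roots.toList, List.map_ofFn]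
  rfl

/-- A positive functional `T` exact on polynomials of degree at most `k` differs from the integral
on `f` by at most `2 ∫ q`, provided `f` is within `q` of a polynomial `p`, both of degree at most
`k`. -/
theorem abs_integral_sub_le_of_abs_sub_le {k : ℕ} {E : Submodule ℝ (ℝ → ℝ)}
    (hEpoly : ∀ p : ℝ[X], (fun t : ℝ => p.eval t) ∈ E) {T : E →ₗ[ℝ] ℝ}
    (hTpos : ∀ g h : E, (∀ t ∈ Icc (-1 : ℝ) 1, (g : ℝ → ℝ) t ≤ (h : ℝ → ℝ) t) → T g ≤ T h)
    (hTexact : ∀ p : ℝ[X], p.natDegree ≤ k →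
      T ⟨fun t : ℝ => p.eval t, hEpoly p⟩ = ∫ t in (-1 : ℝ)..1, p.eval t)
    {f : ℝ → ℝ} (hfE : f ∈ E) (hf : ContinuousOn f (Icc (-1) 1)) {p q : ℝ[X]}
    (hp : p.natDegree ≤ k) (hq : q.natDegree ≤ k)
    (h : ∀ t ∈ Icc (-1 : ℝ) 1, |f t - p.eval t| ≤ q.eval t) :
    |(∫ t in (-1 : ℝ)..1, f t) - T ⟨f, hfE⟩| ≤ 2 * ∫ t in (-1 : ℝ)..1, q.eval t := by
  have hint : ∀ r : ℝ[X], IntervalIntegrable (fun t => r.eval t) MeasureTheory.volume (-1) 1 :=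
    fun r => r.continuous.intervalIntegrable _ _
  have hfint : IntervalIntegrable f MeasureTheory.volume (-1) 1 :=
    hf.intervalIntegrable_of_Icc (by norm_num)
  have hlow : ∀ t ∈ Icc (-1 : ℝ) 1, (p - q).eval t ≤ f t := fun t ht => by
    rw [eval_sub]
    linarith [(abs_le.1 (h t ht)).1]
  have hupp : ∀ t ∈ Icc (-1 : ℝ) 1, f t ≤ (p + q).eval t := fun t ht => by
    rw [eval_add]
    linarith [(abs_le.1 (h t ht)).2]
  have hT1 := hTpos ⟨_, hEpoly (p - q)⟩ ⟨f, hfE⟩ hlow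
  have hT2 := hTpos ⟨f, hfE⟩ ⟨_, hEpoly (p + q)⟩ hupp
  have hI1 := intervalIntegral.integral_mono_on (by norm_num) (hint (p - q)) hfint hlow
  have hI2 := intervalIntegral.integral_mono_on (by norm_num) hfint (hint (p + q)) hupp
  rw [hTexact _ ((natDegree_sub_le _ _).trans (max_le hp hq))] at hT1
  rw [hTexact _ ((natDegree_add_le _ _).trans (max_le hp hq))] at hT2
  simp only [eval_sub, intervalIntegral.integral_sub (hint p) (hint q)] at hT1 hI1
  simp only [eval_add, intervalIntegral.integral_add (hint p) (hint q)] at hT2 hI2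
  rw [abs_le]
  constructor <;> linarith

/-- `errConst k` is `2 / k!` times the integral of the Gauss or Radau nodal polynomial of degree
`k`. -/
theorem errConst_eq {k n b : ℕ} (hk : k = 2 * n + b) (hb : b ≤ 1) :
    2 / (k.factorial : ℝ) * (2 ^ (2 * n + b + 1) * (n.factorial : ℝ) ^ 2 *
      ((n + b).factorial : ℝ) ^ 2 / ((2 * n + b).factorial * (2 * n + b + 1).factorial)) =
    errConst k := by
  have hf : ∀ m : ℕ, (m.factorial : ℝ) ≠ 0 := fun m => by exact_mod_cast m.factorial_ne_zero
  have h4 : (4 : ℝ) ^ (n + 1) = 2 ^ (2 * n + 2) := by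
    rw [show (4 : ℝ) = 2 ^ 2 by norm_num, ← pow_mul]
    ring
  have hn := hf n
  obtain rfl | rfl : b = 0 ∨ b = 1 := by omega
  · have h1 : k % 2 = 0 := by omega
    have h2 : k / 2 = n := by omega
    have h3 := hf (2 * n)
    have h5 : (2 * (n : ℝ) + 1) ≠ 0 := by positivity
    rw [errConst, if_pos h1, h2, h4, hk]
    simp only [add_zero, Nat.factorial_succ]
    push_cast
    field_simp
    ring
  · have h1 : k % 2 ≠ 0 := by omega
    have h2 : k / 2 = n := by omega
    have h3 := hf (2 * n + 1)
    have h5 : ((n : ℝ) + 1) ≠ 0 := by positivity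
    have h6 : ((2 * n + 1 + 1).factorial : ℝ) = 2 * (n + 1) * (2 * n + 1).factorial := by
      rw [Nat.factorial_succ (2 * n + 1)]
      push_cast
      ring
    rw [errConst, if_neg h1, h2, h4, hk, h6, Nat.factorial_succ n]
    push_cast
    field_simp

/-- Theorem: a positive linear functional `T`, defined on a subspace of
functions `[-1,1] → ℝ` containing all `C^k` functions and all `(k-1)`-convex
functions, which is exact on `Π_k`, satisfies
`|I(f) - T(f)| ≤ α_k ‖f⁽ᵏ⁾‖` for every `f ∈ C^k([-1,1])`. -/
theorem abs_integral_sub_positive_functional_le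
    (k : ℕ) (hk : 2 ≤ k)
    (E : Submodule ℝ (ℝ → ℝ))
    (hEck : ∀ f : ℝ → ℝ, ContDiffOn ℝ (k : ℕ∞) f (Set.Icc (-1 : ℝ) 1) → f ∈ E)
    (hEconv : ∀ g : ℝ → ℝ, NConvexOn (k - 1) (Set.Icc (-1 : ℝ) 1) g → g ∈ E)
    (hEpoly : ∀ p : Polynomial ℝ, (fun t : ℝ => p.eval t) ∈ E)
    (T : E →ₗ[ℝ] ℝ)
    (hTpos : ∀ g h : E, (∀ t ∈ Set.Icc (-1 : ℝ) 1, (g : ℝ → ℝ) t ≤ (h : ℝ → ℝ) t) →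
      T g ≤ T h)
    (hTexact : ∀ p : Polynomial ℝ, p.natDegree ≤ k →
      T ⟨fun t : ℝ => p.eval t, hEpoly p⟩ = ∫ t in (-1 : ℝ)..1, p.eval t)
    (f : ℝ → ℝ) (hf : ContDiffOn ℝ (k : ℕ∞) f (Set.Icc (-1 : ℝ) 1)) :
    |(∫ t in (-1 : ℝ)..1, f t) - T ⟨f, hEck f hf⟩| ≤
      errConst k * supNormIcc (iteratedDerivWithin k f (Set.Icc (-1 : ℝ) 1)) := by
  set M := supNormIcc (iteratedDerivWithin k f (Icc (-1 : ℝ) 1)) with hMdef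
  have hlt : (-1 : ℝ) < 1 := by norm_num
  have hM : ∀ x ∈ Icc (-1 : ℝ) 1, |iteratedDerivWithin k f (Icc (-1 : ℝ) 1) x| ≤ M := by
    intro x hx
    have hcont : ContinuousOn (fun t => |iteratedDerivWithin k f (Icc (-1 : ℝ) 1) t|)
        (Icc (-1) 1) :=
      (hf.continuousOn_iteratedDerivWithin le_rfl (uniqueDiffOn_Icc hlt)).abs
    exact le_csSup (isCompact_Icc.bddAbove_image hcont) (mem_image_of_mem _ hx)
  obtain ⟨n, b, hb, hkn⟩ : ∃ n b, b ≤ 1 ∧ k = 2 * n + b := ⟨k / 2, k % 2, by omega, by omega⟩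
  obtain ⟨W, hWmonic, hWdeg, hWsplits, hWroots, hWnonneg, hWint⟩ := exists_nodal_polynomial n b
  rw [← hkn] at hWdeg
  obtain ⟨v, hv, hWv⟩ := exists_eq_prod_X_sub_C hWmonic hWsplits hWdeg
  have hle : ∀ ε > 0, |(∫ t in (-1 : ℝ)..1, f t) - T ⟨f, hEck f hf⟩| ≤ errConst k * M + ε := by
    intro ε hε
    obtain ⟨p, hp, hfp⟩ := exists_polynomial_abs_sub_le hlt hf hM (fun i => hWroots _ (hv i))
      (fun t ht => hWv t ▸ hWnonneg t ht) (ε := ε / 4) (by positivity)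
    have hq : (C (M / k.factorial) * W + C (ε / 4)).natDegree ≤ k :=
      natDegree_add_le_of_degree_le ((natDegree_C_mul_le _ _).trans hWdeg.le) (by simp)
    refine (abs_integral_sub_le_of_abs_sub_le hEpoly hTpos hTexact (hEck f hf) hf.continuousOn
      hp hq fun t ht => ?_).trans_eq ?_
    · simpa [hWv] using hfp t ht
    · simp only [eval_add, eval_C_mul, eval_C]
      rw [intervalIntegral.integral_add
          (Continuous.intervalIntegrable (by fun_prop) _ _)
          (Continuous.intervalIntegrable (by fun_prop) _ _),
        intervalIntegral.integral_const_mul, hWint, intervalIntegral.integral_const,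
        ← errConst_eq hkn hb, smul_eq_mul]
      ring
  exact le_of_forall_pos_le_add hle
end

section
/- For n ∈ ℕ, n ≥ 1, set α_{2n} := 4^{n+1}(n!)^4 / ((2n+1)((2n)!)^3) and α_{2n+1} := 4^{n+1}(n+1)(n!)^4 / (((2n+1)!)^3). Fix k, N ∈ ℕ, k ≥ 2, points ξ_1,…,ξ_N ∈ [−1,1] and weights λ_1,…,λ_N ≥ 0, and let T(f) := Σ_{j=1}^N λ_j f(ξ_j) for f : [−1,1] → ℝ. If Σ_{j=1}^N λ_j p(ξ_j) = ∫_{−1}^{1} p(x)dx for every polynomial p of degree at most k, then |∫_{−1}^{1} f(x)dx − T(f)| ≤ α_k ‖f^{(k)}‖ for every f ∈ C^k([−1,1]). -/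
open Polynomial in
/-- The derivative of a real-rooted polynomial is real-rooted. -/
theorem splits_derivative {p : ℝ[X]} (hp : p.Splits) : (derivative p).Splits := by
  rw [splits_iff_card_roots] at hp ⊢
  have h := card_roots_le_derivative p
  have h' := natDegree_derivative_le p
  have h'' := card_roots' (derivative p)
  omega

open Polynomial in
theorem splits_iterate_derivative {p : ℝ[X]} (hp : p.Splits) (n : ℕ) :
    (derivative^[n] p).Splits := by
  induction n with
  | zero => exact hp
  | succ n ih => rw [Function.iterate_succ_apply']; exact splits_derivative ih

open Polynomial in
/-- Iterated integration by parts against a polynomial vanishing to order `n` at `±1`. -/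
theorem integral_mul_iterate_derivative (n : ℕ) (q u : ℝ[X]) (h₁ : (X - C 1) ^ n ∣ u)
    (h₂ : (X + C 1) ^ n ∣ u) :
    ∫ x in (-1 : ℝ)..1, q.eval x * (derivative^[n] u).eval x =
      (-1) ^ n * ∫ x in (-1 : ℝ)..1, (derivative^[n] q).eval x * u.eval x := by
  induction n generalizing q with
  | zero => simp
  | succ n ih =>
    have e₁ : (derivative^[n] u).eval 1 = 0 := by
      have h := pow_sub_dvd_iterate_derivative_of_pow_dvd n h₁
      rw [Nat.add_sub_cancel_left, pow_one] at h
      exact dvd_iff_isRoot.1 h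
    have e₂ : (derivative^[n] u).eval (-1) = 0 := by
      have h := pow_sub_dvd_iterate_derivative_of_pow_dvd n h₂
      rw [Nat.add_sub_cancel_left, pow_one] at h
      exact dvd_iff_isRoot.1 (by simpa using h)
    have h := intervalIntegral.integral_mul_deriv_eq_deriv_mul (a := -1) (b := 1)
      (fun x _ => q.hasDerivAt x) (fun x _ => (derivative^[n] u).hasDerivAt x)
      ((derivative q).continuous.intervalIntegrable _ _)
      ((derivative (derivative^[n] u)).continuous.intervalIntegrable _ _)
    rw [Function.iterate_succ_apply', h, e₁, e₂,
      ih _ (dvd_trans (pow_dvd_pow _ n.le_succ) h₁) (dvd_trans (pow_dvd_pow _ n.le_succ) h₂),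
      Function.iterate_succ_apply]
    ring

theorem integral_one_sub_pow_mul_one_add_pow (n m : ℕ) :
    ∫ x in (-1 : ℝ)..1, (1 - x) ^ n * (1 + x) ^ m =
      2 ^ (n + m + 1) * n.factorial * m.factorial / (n + m + 1).factorial := by
  induction n generalizing m with
  | zero =>
    have h : ∀ x ∈ Set.uIcc (-1 : ℝ) 1,
        HasDerivAt (fun x : ℝ => (1 + x) ^ (m + 1) / (m + 1)) ((1 + x) ^ m) x := by
      intro x _
      have h := (((hasDerivAt_id x).const_add 1).pow (m + 1)).div_const ((m : ℝ) + 1)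
      refine h.congr_deriv ?_
      simp
      field_simp
    have := intervalIntegral.integral_eq_sub_of_hasDerivAt h
      (Continuous.intervalIntegrable (by fun_prop) _ _)
    simp only [pow_zero, one_mul, this]
    rw [zero_add, Nat.factorial_succ]
    have : (m.factorial : ℝ) ≠ 0 := by positivity
    norm_num
    field_simp
  | succ n ih =>
    have h : ∀ x ∈ Set.uIcc (-1 : ℝ) 1,
        HasDerivAt (fun x : ℝ => (1 - x) ^ (n + 1) * (1 + x) ^ (m + 1))
          ((m + 1) * ((1 - x) ^ (n + 1) * (1 + x) ^ m) -
            (n + 1) * ((1 - x) ^ n * (1 + x) ^ (m + 1))) x := by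
      intro x _
      have h := (((hasDerivAt_id x).const_sub 1).pow (n + 1)).mul
        (((hasDerivAt_id x).const_add 1).pow (m + 1))
      refine h.congr_deriv ?_
      simp
      ring
    have h := intervalIntegral.integral_eq_sub_of_hasDerivAt h
      (Continuous.intervalIntegrable (by fun_prop) _ _)
    rw [intervalIntegral.integral_sub (Continuous.intervalIntegrable (by fun_prop) _ _)
      (Continuous.intervalIntegrable (by fun_prop) _ _), intervalIntegral.integral_const_mul,
      intervalIntegral.integral_const_mul, ih (m + 1)] at h
    simp only [sub_self, add_neg_cancel, zero_pow n.succ_ne_zero, zero_pow m.succ_ne_zero,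
      zero_mul, mul_zero] at h
    rw [← mul_right_inj' (show (m : ℝ) + 1 ≠ 0 by positivity), sub_eq_zero.1 h,
      show n + (m + 1) + 1 = n + 1 + m + 1 by ring]
    simp only [Nat.factorial_succ n, Nat.factorial_succ m]
    push_cast
    ring

open Polynomial in
/-- Existence of a monic real-rooted polynomial of degree `n` (a Jacobi polynomial) with
prescribed weighted `L²` norm for the weight `(1 + x) ^ a`. -/
theorem exists_monic_splits_integral_sq (n a : ℕ) :
    ∃ q : ℝ[X], q.Monic ∧ q.Splits ∧ q.natDegree = n ∧
      ∫ x in (-1 : ℝ)..1, (1 + x) ^ a * q.eval x ^ 2 =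
        2 ^ (2 * n + a + 1) * (n.factorial : ℝ) ^ 2 * ((n + a).factorial : ℝ) ^ 2 /
          ((2 * n + a).factorial * (2 * n + a + 1).factorial) := by
  set u : ℝ[X] := (X - C 1) ^ n * (X + C 1) ^ (n + a) with hu
  have hum : u.Monic := ((monic_X_sub_C _).pow _).mul ((monic_X_add_C _).pow _)
  have hud : u.natDegree = 2 * n + a := by
    rw [hu, Monic.natDegree_mul ((monic_X_sub_C _).pow _) ((monic_X_add_C _).pow _),
      natDegree_pow, natDegree_pow, natDegree_X_sub_C, natDegree_X_add_C]
    ring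
  have hus : u.Splits := ((Splits.X_sub_C _).pow _).mul ((Splits.X_add_C _).pow _)
  set w : ℝ[X] := derivative^[n] u with hw
  set c : ℝ := (2 * n + a).factorial / (n + a).factorial with hc
  have hc0 : c ≠ 0 := by positivity
  have hwn : w.coeff (n + a) = c := by
    rw [hw, coeff_iterate_derivative,
      show n + a + n = 2 * n + a by ring, ← hud, coeff_natDegree, hum.leadingCoeff, hud,
      nsmul_eq_mul, mul_one, hc, eq_div_iff (by positivity), mul_comm]
    have := Nat.factorial_mul_descFactorial (show n ≤ 2 * n + a by omega)
    rw [show 2 * n + a - n = n + a by omega] at this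
    exact_mod_cast this
  have hwd : w.natDegree = n + a := by
    refine natDegree_eq_of_le_of_coeff_ne_zero
      ((natDegree_iterate_derivative u n).trans (by omega)) ?_
    rw [hwn]
    exact hc0
  have hwc : w.leadingCoeff = c := by rw [leadingCoeff, hwd, hwn]
  have hw0 : w ≠ 0 := leadingCoeff_ne_zero.1 (hwc ▸ hc0)
  obtain ⟨q, hq⟩ : (X + C 1) ^ a ∣ w := by
    have h := pow_sub_dvd_iterate_derivative_of_pow_dvd n
      (Dvd.intro_left _ rfl : (X + C (1 : ℝ)) ^ (n + a) ∣ u)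
    rwa [Nat.add_sub_cancel_left] at h
  have hqc : q.leadingCoeff = c := by
    rw [← hwc, hq, leadingCoeff_monic_mul ((monic_X_add_C _).pow _)]
  have hq0 : q ≠ 0 := leadingCoeff_ne_zero.1 (hqc ▸ hc0)
  have hqd : q.natDegree = n := by
    have h := hwd
    rw [hq, Monic.natDegree_mul' ((monic_X_add_C _).pow _) hq0, natDegree_pow,
      natDegree_X_add_C] at h
    omega
  have hqs : q.Splits :=
    (splits_iterate_derivative hus n).of_dvd hw0 (Dvd.intro_left _ hq.symm)
  refine ⟨C c⁻¹ * q, ?_, hqs.C_mul _, ?_, ?_⟩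
  · rw [Monic, leadingCoeff_mul, leadingCoeff_C, hqc, inv_mul_cancel₀ hc0]
  · rw [natDegree_C_mul (inv_ne_zero hc0), hqd]
  · have h := integral_mul_iterate_derivative n q u (Dvd.intro _ rfl)
      (dvd_trans (pow_dvd_pow _ (Nat.le_add_right n a)) (Dvd.intro_left _ rfl))
    have hDq : derivative^[n] q = C (n.factorial * c) := by
      rw [eq_C_of_natDegree_eq_zero (p := derivative^[n] q)
        (by
          have := natDegree_iterate_derivative q n
          omega), coeff_iterate_derivative, zero_add,
        Nat.descFactorial_self, ← hqc, leadingCoeff, hqd, nsmul_eq_mul]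
    have e₁ : ∀ x : ℝ, (1 + x) ^ a * (C c⁻¹ * q).eval x ^ 2 =
        c⁻¹ ^ 2 * (q.eval x * w.eval x) := by
      intro x
      rw [hq]
      simp
      ring
    have e₂ : ∀ x : ℝ, (derivative^[n] q).eval x * u.eval x =
        (n.factorial * c * (-1) ^ n) * ((1 - x) ^ n * (1 + x) ^ (n + a)) := by
      intro x
      rw [hDq, hu]
      have : x - 1 = -1 * (1 - x) := by ring
      simp only [eval_C, eval_mul, eval_pow, eval_sub, eval_add, eval_X, this, mul_pow]
      ring
    simp only [e₁, intervalIntegral.integral_const_mul]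
    rw [hw, h]
    simp only [e₂, intervalIntegral.integral_const_mul]
    rw [integral_one_sub_pow_mul_one_add_pow, hc, show n + (n + a) + 1 = 2 * n + a + 1 by ring]
    have : ((-1 : ℝ) ^ n) * (-1) ^ n = 1 := by rw [← mul_pow]; simp
    field_simp
    linear_combination this

/-- `F 0` is a `k` times continuously differentiable function with derivatives `F 1, …, F k`, the
last one being bounded by `M`. -/
structure IsDerivChain (k : ℕ) (M : ℝ) (F : ℕ → ℝ → ℝ) : Prop where
  hasDerivAt : ∀ i < k, ∀ x, HasDerivAt (F i) (F (i + 1) x) x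
  continuous_last : Continuous (F k)
  abs_last_le : ∀ x, |F k x| ≤ M

theorem IsDerivChain.continuous {k : ℕ} {M : ℝ} {F : ℕ → ℝ → ℝ} (hF : IsDerivChain k M F)
    {i : ℕ} (hi : i ≤ k) : Continuous (F i) := by
  rcases hi.lt_or_eq with h | rfl
  · exact continuous_iff_continuousAt.2 fun x => (hF.hasDerivAt i h x).continuousAt
  · exact hF.continuous_last

open Set in
/-- A `C^k` function on `[a, b]` extends to a `C^k` function on `ℝ` without increasing the bound
for the `k`-th derivative. -/
theorem ContDiffOn.exists_isDerivChain {a b M : ℝ} (hab : a < b) (k : ℕ) (f : ℝ → ℝ)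
    (hf : ContDiffOn ℝ k f (Icc a b))
    (hM : ∀ x ∈ Icc a b, |iteratedDerivWithin k f (Icc a b) x| ≤ M) :
    ∃ F, IsDerivChain k M F ∧ EqOn (F 0) f (Icc a b) := by
  induction k generalizing f with
  | zero =>
    refine ⟨fun _ => IccExtend hab.le ((Icc a b).domRestrict f),
      ⟨by simp, (continuousOn_iff_continuous_domRestrict.1 hf.continuousOn).Icc_extend', ?_⟩, ?_⟩
    · intro x
      simpa [IccExtend, domRestrict] using hM _ (projIcc a b hab.le x).2
    · intro x hx
      simp [IccExtend, domRestrict, projIcc_of_mem hab.le hx]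
  | succ k ih =>
    have hu := uniqueDiffOn_Icc hab
    obtain ⟨hd, -, hc⟩ := (contDiffOn_succ_iff_derivWithin (n := (k : WithTop ℕ∞)) hu).1
      (by exact_mod_cast hf)
    obtain ⟨F, hF, hF0⟩ := ih _ hc (fun x hx => by
      rw [← iteratedDerivWithin_succ']; exact hM x hx)
    have hcont := hF.continuous k.zero_le
    have hG : ∀ x, HasDerivAt (fun x => f a + ∫ t in a..x, F 0 t) (F 0 x) x := fun x =>
      ((hcont.integral_hasStrictDerivAt a x).hasDerivAt).const_add _
    refine ⟨fun i => Nat.casesOn i (fun x => f a + ∫ t in a..x, F 0 t) F, ⟨?_, ?_, ?_⟩, ?_⟩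
    · rintro (_ | i) hi x
      · exact hG x
      · exact hF.hasDerivAt i (by omega) x
    · exact hF.continuous_last
    · exact hF.abs_last_le
    · refine eq_of_derivWithin_eq (fun x _ => (hG x).differentiableAt.differentiableWithinAt) hd
        (fun x hx => ?_) (by simp)
      have hx' : x ∈ Icc a b := ⟨hx.1, hx.2.le⟩
      rw [← hF0 hx']
      exact (hG x).hasDerivWithinAt.derivWithin (hu x hx')

theorem hasDerivAt_integral_pow_mul {g g' : ℝ → ℝ} (hg : ∀ x, HasDerivAt g (g' x) x)
    (hg' : Continuous g') (a : ℝ) (i : ℕ) (x : ℝ) :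
    HasDerivAt (fun x => ∫ s in (0 : ℝ)..1, s ^ i * g (a + s * (x - a)))
      (∫ s in (0 : ℝ)..1, s ^ (i + 1) * g' (a + s * (x - a))) x := by
  have hgc : Continuous g := continuous_iff_continuousAt.2 fun x => (hg x).continuousAt
  have hcont : Continuous (fun p : ℝ × ℝ => p.1 ^ (i + 1) * g' (a + p.1 * (p.2 - a))) := by
    fun_prop
  obtain ⟨B, hB⟩ := (isCompact_Icc.prod (isCompact_closedBall x 1)).exists_bound_of_continuousOn
    (s := Set.Icc (0 : ℝ) 1 ×ˢ Metric.closedBall x 1) hcont.continuousOn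
  refine (intervalIntegral.hasDerivAt_integral_of_dominated_loc_of_deriv_le
    (F := fun x s => s ^ i * g (a + s * (x - a)))
    (F' := fun x s => s ^ (i + 1) * g' (a + s * (x - a))) (bound := fun _ => B)
    (Metric.closedBall_mem_nhds x one_pos) ?_ ?_ ?_ ?_ ?_ ?_).2
  · exact .of_forall fun y => (Continuous.aestronglyMeasurable (by fun_prop))
  · exact Continuous.intervalIntegrable (by fun_prop) _ _
  · exact Continuous.aestronglyMeasurable (by fun_prop)
  · refine .of_forall fun s hs y hy => hB (s, y) ⟨?_, hy⟩
    rw [Set.uIoc_of_le zero_le_one] at hs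
    exact ⟨hs.1.le, hs.2⟩
  · exact intervalIntegrable_const
  · refine .of_forall fun s _ y _ => ?_
    have h := ((hg (a + s * (y - a))).comp y
      ((((hasDerivAt_id y).sub_const a).const_mul s).const_add a)).const_mul (s ^ i)
    exact h.congr_deriv (by ring)

/-- The divided difference `x ↦ (F 0 x - F 0 a) / (x - a)` of a `C^(k+1)` function. -/
theorem IsDerivChain.exists_dividedDifference {k : ℕ} {M : ℝ} {F : ℕ → ℝ → ℝ}
    (hF : IsDerivChain (k + 1) M F) (a : ℝ) :
    ∃ G, IsDerivChain k (M / (k + 1)) G ∧ ∀ x, F 0 x = F 0 a + (x - a) * G 0 x := by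
  refine ⟨fun i x => ∫ s in (0 : ℝ)..1, s ^ i * F (i + 1) (a + s * (x - a)), ⟨?_, ?_, ?_⟩, ?_⟩
  · intro i hi x
    exact hasDerivAt_integral_pow_mul (hF.hasDerivAt (i + 1) (by omega))
      (hF.continuous (by omega)) a i x
  · have := hF.continuous_last
    exact intervalIntegral.continuous_parametric_intervalIntegral_of_continuous' (by fun_prop) _ _
  · intro x
    have h : ∫ s in (0 : ℝ)..1, s ^ k * M = M / (k + 1) := by
      rw [intervalIntegral.integral_mul_const, integral_pow]
      simp
      ring
    rw [← h, ← Real.norm_eq_abs]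
    refine intervalIntegral.norm_integral_le_of_norm_le zero_le_one (.of_forall fun s hs => ?_)
      (Continuous.intervalIntegrable (by fun_prop) _ _)
    rw [norm_mul, norm_pow, Real.norm_of_nonneg hs.1.le]
    have := hs.1.le
    gcongr
    exact hF.abs_last_le _
  · intro x
    have hc := hF.continuous (i := 1) (by omega)
    have h : ∀ s ∈ Set.uIcc (0 : ℝ) 1, HasDerivAt (fun s => F 0 (a + s * (x - a)))
        ((x - a) * F 1 (a + s * (x - a))) s := by
      intro s _
      have h := (hF.hasDerivAt 0 (by omega) (a + s * (x - a))).comp s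
        (((hasDerivAt_id s).mul_const (x - a)).const_add a)
      exact h.congr_deriv (by ring)
    have h := intervalIntegral.integral_eq_sub_of_hasDerivAt h
      (Continuous.intervalIntegrable (by fun_prop) _ _)
    rw [intervalIntegral.integral_const_mul] at h
    simp only [pow_zero, one_mul, zero_add, h]
    simp

open Polynomial in
/-- Error bound for Hermite interpolation at the points of a multiset. -/
theorem IsDerivChain.exists_abs_sub_eval_le (s : Multiset ℝ) {M : ℝ} {F : ℕ → ℝ → ℝ}
    (hF : IsDerivChain s.card M F) :
    ∃ p : ℝ[X], p.natDegree ≤ s.card ∧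
      ∀ x, |F 0 x - p.eval x| ≤ M / s.card.factorial * |(s.map (x - ·)).prod| := by
  induction s using Multiset.induction_on generalizing M F with
  | empty => exact ⟨0, by simp, fun x => by simpa using hF.abs_last_le x⟩
  | cons a s ih =>
    rw [Multiset.card_cons] at hF
    obtain ⟨G, hG, hFG⟩ := hF.exists_dividedDifference a
    obtain ⟨p, hp, hpx⟩ := ih hG
    refine ⟨C (F 0 a) + (X - C a) * p, ?_, fun x => ?_⟩
    · rw [natDegree_C_add, Multiset.card_cons, add_comm]
      exact natDegree_mul_le.trans (by rw [natDegree_X_sub_C]; omega)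
    · have h := mul_le_mul_of_nonneg_left (hpx x) (abs_nonneg (x - a))
      rw [← abs_mul] at h
      rw [Multiset.map_cons, Multiset.prod_cons, Multiset.card_cons, Nat.factorial_succ, hFG,
        abs_mul]
      have e : F 0 a + (x - a) * G 0 x - (C (F 0 a) + (X - C a) * p).eval x =
          (x - a) * (G 0 x - p.eval x) := by
        simp
        ring
      rw [e]
      refine h.trans_eq ?_
      push_cast
      field_simp

theorem abs_le_supNormIcc_s18 {g : ℝ → ℝ} (hg : ContinuousOn g (Set.Icc (-1) 1)) {x : ℝ}
    (hx : x ∈ Set.Icc (-1 : ℝ) 1) : |g x| ≤ supNormIcc g :=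
  le_csSup (isCompact_Icc.image_of_continuousOn hg.abs).bddAbove (Set.mem_image_of_mem _ hx)

theorem errConst_two_mul_add {n a : ℕ} (ha : a < 2) :
    errConst (2 * n + a) = 2 / (2 * n + a).factorial *
      (2 ^ (2 * n + a + 1) * (n.factorial : ℝ) ^ 2 * ((n + a).factorial : ℝ) ^ 2 /
        ((2 * n + a).factorial * (2 * n + a + 1).factorial)) := by
  have h4 : (4 : ℝ) ^ (n + 1) = 2 ^ (2 * n + 1) * 2 := by
    rw [← pow_succ, show 2 * n + 1 + 1 = 2 * (n + 1) by ring, pow_mul]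
    norm_num
  interval_cases a
  · rw [errConst, if_pos (by omega), show (2 * n + 0) / 2 = n by omega, h4]
    simp only [add_zero, Nat.factorial_succ (2 * n)]
    push_cast
    field_simp
  · rw [errConst, if_neg (by omega), show (2 * n + 1) / 2 = n by omega, h4,
      Nat.factorial_succ (2 * n + 1), Nat.factorial_succ n, pow_succ (2 : ℝ) (2 * n + 1)]
    push_cast
    field_simp
    ring

open Polynomial in
/-- A positive quadrature rule inherits an error bound from polynomial approximation with error
dominated by a polynomial integrated exactly. -/
theorem abs_integral_sub_sum_le_of_abs_sub_eval_le {k N : ℕ} {ξ lam : Fin N → ℝ}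
    (hξ : ∀ j, ξ j ∈ Set.Icc (-1 : ℝ) 1) (hlam : ∀ j, 0 ≤ lam j)
    (hT : ∀ p : ℝ[X], p.natDegree ≤ k →
      ∑ j, lam j * p.eval (ξ j) = ∫ t in (-1 : ℝ)..1, p.eval t)
    {f : ℝ → ℝ} (hf : ContinuousOn f (Set.Icc (-1) 1)) {p ω : ℝ[X]} (hp : p.natDegree ≤ k)
    (hω : ω.natDegree ≤ k) (h : ∀ x ∈ Set.Icc (-1 : ℝ) 1, |f x - p.eval x| ≤ ω.eval x) :
    |(∫ t in (-1 : ℝ)..1, f t) - ∑ j, lam j * f (ξ j)| ≤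
      2 * ∫ t in (-1 : ℝ)..1, ω.eval t := by
  have hle : (-1 : ℝ) ≤ 1 := by norm_num
  have hfi : IntervalIntegrable f MeasureTheory.volume (-1) 1 :=
    ContinuousOn.intervalIntegrable (by rwa [Set.uIcc_of_le hle])
  have hI : |∫ t in (-1 : ℝ)..1, (f t - p.eval t)| ≤ ∫ t in (-1 : ℝ)..1, ω.eval t := by
    rw [← Real.norm_eq_abs]
    exact intervalIntegral.norm_integral_le_of_norm_le hle
      (.of_forall fun t ht => h t (Set.Ioc_subset_Icc_self ht))
      (ω.continuous.intervalIntegrable _ _)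
  have hS : |∑ j, lam j * (f (ξ j) - p.eval (ξ j))| ≤ ∫ t in (-1 : ℝ)..1, ω.eval t := by
    rw [← hT ω hω]
    refine (Finset.abs_sum_le_sum_abs _ _).trans (Finset.sum_le_sum fun j _ => ?_)
    rw [abs_mul, abs_of_nonneg (hlam j)]
    exact mul_le_mul_of_nonneg_left (h _ (hξ j)) (hlam j)
  have e : (∫ t in (-1 : ℝ)..1, f t) - ∑ j, lam j * f (ξ j) =
      (∫ t in (-1 : ℝ)..1, (f t - p.eval t)) - ∑ j, lam j * (f (ξ j) - p.eval (ξ j)) := by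
    rw [intervalIntegral.integral_sub hfi (p.continuous.intervalIntegrable _ _), ← hT p hp]
    simp only [mul_sub, Finset.sum_sub_distrib]
    ring
  rw [e, two_mul]
  exact (abs_sub _ _).trans (add_le_add hI hS)

/-- Error bound for quadrature operators: if `T(f) = ∑ λⱼ f(ξⱼ)` has nonnegative
weights, nodes in `[-1,1]`, and is exact on `Π_k`, then
`|∫_{-1}^1 f - T(f)| ≤ α_k ‖f⁽ᵏ⁾‖` for every `f ∈ C^k([-1,1])`. -/
theorem abs_integral_sub_quadrature_le
    (k N : ℕ) (hk : 2 ≤ k)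
    (ξ : Fin N → ℝ) (hξ : ∀ j, ξ j ∈ Set.Icc (-1 : ℝ) 1)
    (lam : Fin N → ℝ) (hlam : ∀ j, 0 ≤ lam j)
    (hT : ∀ p : Polynomial ℝ, p.natDegree ≤ k →
      ∑ j, lam j * p.eval (ξ j) = ∫ t in (-1 : ℝ)..1, p.eval t)
    (f : ℝ → ℝ) (hf : ContDiffOn ℝ (k : ℕ∞) f (Set.Icc (-1 : ℝ) 1)) :
    |(∫ t in (-1 : ℝ)..1, f t) - ∑ j, lam j * f (ξ j)| ≤
      errConst k * supNormIcc (iteratedDerivWithin k f (Set.Icc (-1 : ℝ) 1)) := by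
  open Polynomial in
  have hf' : ContDiffOn ℝ k f (Set.Icc (-1 : ℝ) 1) := by exact_mod_cast hf
  set M := supNormIcc (iteratedDerivWithin k f (Set.Icc (-1 : ℝ) 1))
  have hlt : (-1 : ℝ) < 1 := by norm_num
  obtain ⟨F, hF, hFf⟩ := hf'.exists_isDerivChain hlt k f fun x hx => abs_le_supNormIcc_s18
    (hf'.continuousOn_iteratedDerivWithin le_rfl (uniqueDiffOn_Icc hlt)) hx
  obtain ⟨n, a, ha, rfl⟩ : ∃ n a, a < 2 ∧ k = 2 * n + a :=
    ⟨k / 2, k % 2, Nat.mod_lt _ two_pos, (Nat.div_add_mod k 2).symm⟩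
  obtain ⟨q, hqm, hqs, hqd, hqi⟩ := exists_monic_splits_integral_sq n a
  set s : Multiset ℝ := q.roots + q.roots + Multiset.replicate a (-1) with hs
  have hcard : s.card = 2 * n + a := by
    rw [hs, Multiset.card_add, Multiset.card_add, Multiset.card_replicate,
      ← hqs.natDegree_eq_card_roots, hqd]
    ring
  have hprod (x : ℝ) : (s.map (x - ·)).prod = (1 + x) ^ a * q.eval x ^ 2 := by
    rw [hqs.eval_eq_prod_roots_of_monic hqm, hs]
    simp only [Multiset.map_add, Multiset.prod_add, Multiset.map_replicate,
      Multiset.prod_replicate]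
    ring
  rw [← hcard] at hF
  obtain ⟨p, hp, hpx⟩ := hF.exists_abs_sub_eval_le
  rw [hcard] at hp hpx
  set d : ℝ := M / (2 * n + a).factorial
  have hω : (C d * ((X + C 1) ^ a * q ^ 2)).natDegree ≤ 2 * n + a := by
    refine (natDegree_C_mul_le _ _).trans (natDegree_mul_le.trans ?_)
    rw [natDegree_pow, natDegree_pow, natDegree_X_add_C, hqd]
    omega
  refine (abs_integral_sub_sum_le_of_abs_sub_eval_le hξ hlam hT hf.continuousOn hp hω
    fun x hx => ?_).trans_eq ?_
  · rw [← hFf hx]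
    refine (hpx x).trans_eq ?_
    have hx' : 0 ≤ 1 + x := by linarith [hx.1]
    rw [hprod, abs_of_nonneg (by positivity)]
    simp [add_comm]
  · have e (x : ℝ) : (C d * ((X + C 1) ^ a * q ^ 2)).eval x =
        d * ((1 + x) ^ a * q.eval x ^ 2) := by
      simp [add_comm]
    simp only [e, intervalIntegral.integral_const_mul, hqi]
    rw [errConst_two_mul_add ha]
    ring
end

section
/- Let f : [−1,1] → ℝ be 3-convex. Then f(−√3/3) + f(√3/3) ≤ (3/11)(f(−1) + f(1)) + (16/11)∫_{−1/2}^{1/2} f(t)dt ≤ (1/3)f(−1) + (4/3)f(0) + (1/3)f(1). (That is, the positive linear functional T(f) = (3/11)[f(−1)+f(1)] + (16/11)∫_{−1/2}^{1/2} f(t)dt, which is exact on Π_3, satisfies G_2(f) ≤ T(f) ≤ Lob_3(f).) -/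
/-- The nonnegativity of the fourth divided difference of a `3`-convex function, written out. -/
lemma NConvexOn.five_points {s : Set ℝ} {f : ℝ → ℝ} (hf : NConvexOn 3 s f) {a b c d e : ℝ}
    (ha : a ∈ s) (hb : b ∈ s) (hc : c ∈ s) (hd : d ∈ s) (he : e ∈ s)
    (hab : a < b) (hbc : b < c) (hcd : c < d) (hde : d < e) :
    0 ≤ f a / ((a - b) * (a - c) * (a - d) * (a - e))
      + f b / ((b - a) * (b - c) * (b - d) * (b - e))
      + f c / ((c - a) * (c - b) * (c - d) * (c - e))
      + f d / ((d - a) * (d - b) * (d - c) * (d - e))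
      + f e / ((e - a) * (e - b) * (e - c) * (e - d)) := by
  have hmono : StrictMono ![a, b, c, d, e] := by
    rw [Fin.strictMono_iff_lt_succ]
    intro i
    fin_cases i <;> assumption
  have h := hf ![a, b, c, d, e] hmono.injective (by intro i; fin_cases i <;> assumption)
  rw [Fin.sum_univ_five] at h
  have e0 : Finset.univ.erase (0 : Fin 5) = {1, 2, 3, 4} := by decide
  have e1 : Finset.univ.erase (1 : Fin 5) = {0, 2, 3, 4} := by decide
  have e2 : Finset.univ.erase (2 : Fin 5) = {0, 1, 3, 4} := by decide
  have e3 : Finset.univ.erase (3 : Fin 5) = {0, 1, 2, 4} := by decide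
  have e4 : Finset.univ.erase (4 : Fin 5) = {0, 1, 2, 3} := by decide
  simp only [Nat.reduceAdd, e0, e1, e2, e3, e4] at h
  simpa [Finset.prod_insert, mul_assoc] using h

/-- The second divided difference of a `3`-convex function with two nodes fixed at the endpoints
is convex in the interior. -/
lemma NConvexOn.convexOn_divided_difference {f : ℝ → ℝ}
    (hf : NConvexOn 3 (Set.Icc (-1 : ℝ) 1) f) :
    ConvexOn ℝ (Set.Ioo (-1 : ℝ) 1)
      (fun x => f x / (x ^ 2 - 1) + f (-1) / (2 * (1 + x)) + f 1 / (2 * (1 - x))) := by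
  refine convexOn_of_slope_mono_adjacent (convex_Ioo _ _) ?_
  rintro x y z ⟨hx, hx'⟩ ⟨hz, hz'⟩ hxy hyz
  have h := hf.five_points (a := -1) (b := x) (c := y) (d := z) (e := 1)
    (by norm_num) ⟨hx.le, hx'.le⟩ ⟨by linarith, by linarith⟩ ⟨hz.le, hz'.le⟩ (by norm_num)
    hx hxy hyz hz'
  rw [← sub_nonneg]
  have hxz : 0 < z - x := by linarith
  refine (mul_nonneg hxz.le h).trans_eq ?_
  have n1 : x + 1 ≠ 0 := by linarith
  have n2 : y + 1 ≠ 0 := by linarith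
  have n3 : z + 1 ≠ 0 := by linarith
  have n4 : 1 - x ≠ 0 := by linarith
  have n5 : 1 - y ≠ 0 := by linarith
  have n6 : 1 - z ≠ 0 := by linarith
  have n7 : y - x ≠ 0 := by linarith
  have n8 : z - y ≠ 0 := by linarith
  have n9 : z - x ≠ 0 := by linarith
  rw [show x ^ 2 - 1 = -((1 - x) * (x + 1)) by ring, show y ^ 2 - 1 = -((1 - y) * (y + 1)) by ring,
    show z ^ 2 - 1 = -((1 - z) * (z + 1)) by ring, show 1 + x = x + 1 by ring,
    show 1 + y = y + 1 by ring, show 1 + z = z + 1 by ring,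
    show x - 1 = -(1 - x) by ring, show y - 1 = -(1 - y) by ring, show z - 1 = -(1 - z) by ring,
    show -1 - x = -(x + 1) by ring, show -1 - y = -(y + 1) by ring,
    show -1 - z = -(z + 1) by ring, show x - -1 = x + 1 by ring, show y - -1 = y + 1 by ring,
    show z - -1 = z + 1 by ring, show x - y = -(y - x) by ring, show x - z = -(z - x) by ring,
    show y - z = -(z - y) by ring]
  field_simp
  ring

lemma NConvexOn.continuousOn_Ioo {f : ℝ → ℝ} (hf : NConvexOn 3 (Set.Icc (-1 : ℝ) 1) f) :
    ContinuousOn f (Set.Ioo (-1 : ℝ) 1) := by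
  have hc := hf.convexOn_divided_difference.continuousOn isOpen_Ioo
  have h1 : ∀ x ∈ Set.Ioo (-1 : ℝ) 1, 2 * (1 + x) ≠ 0 := fun x hx => by linarith [hx.1]
  have h2 : ∀ x ∈ Set.Ioo (-1 : ℝ) 1, 2 * (1 - x) ≠ 0 := fun x hx => by linarith [hx.2]
  have hA : ContinuousOn (fun x : ℝ => f (-1) / (2 * (1 + x))) (Set.Ioo (-1 : ℝ) 1) :=
    continuousOn_const.div (by fun_prop) h1
  have hB : ContinuousOn (fun x : ℝ => f 1 / (2 * (1 - x))) (Set.Ioo (-1 : ℝ) 1) :=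
    continuousOn_const.div (by fun_prop) h2
  have hP : ContinuousOn (fun x : ℝ => x ^ 2 - 1) (Set.Ioo (-1 : ℝ) 1) := by fun_prop
  refine (((hc.sub hA).sub hB).mul hP).congr fun x hx => ?_
  have hx0 : x ^ 2 - 1 ≠ 0 := by nlinarith [hx.1, hx.2]
  simp only [Pi.sub_apply, Pi.mul_apply]
  field_simp
  ring

lemma NConvexOn.add_neg_le {f : ℝ → ℝ} (hf : NConvexOn 3 (Set.Icc (-1 : ℝ) 1) f) {t : ℝ}
    (ht : 0 < t) (ht' : t < 1) :
    f t + f (-t) ≤ t ^ 2 * (f (-1) + f 1) + (1 - t ^ 2) * (2 * f 0) := by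
  have h := hf.five_points (a := -1) (b := -t) (c := 0) (d := t) (e := 1)
    (by norm_num) ⟨by linarith, by linarith⟩ (by norm_num) ⟨by linarith, by linarith⟩
    (by norm_num) (by linarith) (by linarith) ht ht'
  have n1 : 0 < 1 - t := by linarith
  have n2 : 0 < 1 + t := by linarith
  rw [← sub_nonneg]
  refine (mul_nonneg (by positivity : 0 ≤ 2 * t ^ 2 * ((1 - t) * (1 + t))) h).trans_eq ?_
  rw [show -1 - -t = -(1 - t) by ring, show -1 - t = -(1 + t) by ring,
    show -t - -1 = 1 - t by ring, show -t - 1 = -(1 + t) by ring,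
    show t - -1 = 1 + t by ring, show t - 1 = -(1 - t) by ring,
    show 1 - -t = 1 + t by ring, show -t - t = -(2 * t) by ring, show t - -t = 2 * t by ring,
    show (-1 : ℝ) - 1 = -2 by norm_num, show (1 : ℝ) - -1 = 2 by norm_num]
  simp only [sub_zero, zero_sub, neg_neg]
  field_simp
  ring

lemma NConvexOn.le_add_neg {f : ℝ → ℝ} (hf : NConvexOn 3 (Set.Icc (-1 : ℝ) 1) f) {s t : ℝ}
    (hs : s < 1) (hts : -s < t) (hts' : t < s) :
    (1 - t ^ 2) * (f (-s) + f s) - (s ^ 2 - t ^ 2) * (f (-1) + f 1)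
      ≤ (1 - s ^ 2) * (f t + f (-t)) := by
  have key : ∀ u : ℝ, -s < u → u < s →
      0 ≤ (1 - s ^ 2) * f u + (s ^ 2 - u ^ 2) * ((1 + u) * f 1 + (1 - u) * f (-1)) / 2
        - (1 - u ^ 2) * ((s + u) * f s + (s - u) * f (-s)) / (2 * s) := by
    intro u hu hu'
    have h := hf.five_points (a := -1) (b := -s) (c := u) (d := s) (e := 1)
      (by norm_num) ⟨by linarith, by linarith⟩ ⟨by linarith, by linarith⟩
      ⟨by linarith, by linarith⟩ (by norm_num) (by linarith) hu hu' hs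
    have n0 : 0 < s := by linarith
    have n1 : 0 < 1 - s := by linarith
    have n2 : 0 < 1 + s := by linarith
    have n3 : 0 < 1 - u := by linarith
    have n4 : 0 < 1 + u := by linarith
    have n5 : 0 < s - u := by linarith
    have n6 : 0 < s + u := by linarith
    refine (mul_nonneg (by positivity :
      0 ≤ (1 - s) * (1 + s) * ((1 - u) * (1 + u)) * ((s - u) * (s + u))) h).trans_eq ?_
    rw [show -1 - -s = -(1 - s) by ring, show -1 - s = -(1 + s) by ring,
      show -1 - u = -(1 + u) by ring, show -s - -1 = 1 - s by ring,
      show -s - 1 = -(1 + s) by ring, show -s - u = -(s + u) by ring,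
      show -s - s = -(2 * s) by ring, show s - -1 = 1 + s by ring,
      show s - 1 = -(1 - s) by ring, show s - -s = 2 * s by ring,
      show u - -1 = 1 + u by ring, show u - 1 = -(1 - u) by ring,
      show u - -s = s + u by ring, show u - s = -(s - u) by ring,
      show 1 - -s = 1 + s by ring, show (-1 : ℝ) - 1 = -2 by norm_num,
      show (1 : ℝ) - -1 = 2 by norm_num]
    field_simp
    ring
  have h := add_nonneg (key t hts hts') (key (-t) (by linarith) (by linarith))
  have n0 : s ≠ 0 := by linarith
  rw [← sub_nonneg]
  refine h.trans_eq ?_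
  field_simp
  ring

lemma integral_add_mul_sq (A B : ℝ) :
    ∫ t in (-(1 / 2) : ℝ)..(1 / 2), (A + B * t ^ 2) = A + B / 12 := by
  rw [intervalIntegral.integral_add (by simp) (Continuous.intervalIntegrable (by fun_prop) _ _),
    intervalIntegral.integral_const_mul, integral_pow, intervalIntegral.integral_const]
  norm_num
  ring

/-- For a `3`-convex function `f` on `[-1,1]`, the positive linear functional
`T(f) = (3/11)(f(-1)+f(1)) + (16/11)∫_{-1/2}^{1/2} f`, which is exact on `Π₃`,
satisfies `G₂(f) ≤ T(f) ≤ Lob₃(f)`. -/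
theorem gauss_two_le_T_le_lobatto_three
    (f : ℝ → ℝ) (hf : NConvexOn 3 (Set.Icc (-1 : ℝ) 1) f) :
    f (-(Real.sqrt 3 / 3)) + f (Real.sqrt 3 / 3) ≤
      3 / 11 * (f (-1) + f 1) + 16 / 11 * ∫ t in (-(1 / 2) : ℝ)..(1 / 2), f t ∧
    3 / 11 * (f (-1) + f 1) + 16 / 11 * (∫ t in (-(1 / 2) : ℝ)..(1 / 2), f t) ≤
      1 / 3 * f (-1) + 4 / 3 * f 0 + 1 / 3 * f 1 := by
  have hsub : Set.uIcc (-(1 / 2) : ℝ) (1 / 2) ⊆ Set.Ioo (-1) 1 := by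
    rw [Set.uIcc_of_le (by norm_num)]
    exact Set.Icc_subset_Ioo (by norm_num) (by norm_num)
  have hint : IntervalIntegrable f MeasureTheory.volume (-(1 / 2)) (1 / 2) :=
    (hf.continuousOn_Ioo.mono hsub).intervalIntegrable
  have hint' : IntervalIntegrable (fun t => f (-t)) MeasureTheory.volume (-(1 / 2)) (1 / 2) := by
    refine ContinuousOn.intervalIntegrable (hf.continuousOn_Ioo.comp (by fun_prop) fun t ht => ?_)
    have := hsub ht
    exact ⟨by linarith [this.2], by linarith [this.1]⟩
  have hsum : ∫ t in (-(1 / 2) : ℝ)..(1 / 2), (f t + f (-t)) =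
      2 * ∫ t in (-(1 / 2) : ℝ)..(1 / 2), f t := by
    rw [intervalIntegral.integral_add hint hint', intervalIntegral.integral_comp_neg, neg_neg]
    ring
  have hquad (A B : ℝ) : IntervalIntegrable (fun t : ℝ => A + B * t ^ 2)
      MeasureTheory.volume (-(1 / 2)) (1 / 2) := Continuous.intervalIntegrable (by fun_prop) _ _
  constructor
  · set s := Real.sqrt 3 / 3 with hs
    have hs2 : s ^ 2 = 1 / 3 := by
      rw [hs, div_pow, Real.sq_sqrt (by norm_num)]
      norm_num
    have hs0 : 0 ≤ s := by positivity
    have hs1 : s < 1 := by nlinarith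
    have hs3 : 1 / 2 < s := by nlinarith
    have h := intervalIntegral.integral_mono_on (by norm_num)
      (hquad (3 / 2 * (f (-s) + f s) - 1 / 2 * (f (-1) + f 1))
        (3 / 2 * (f (-1) + f 1) - 3 / 2 * (f (-s) + f s))) (hint.add hint') fun t ht => by
        have := hf.le_add_neg hs1 (t := t) (by linarith [ht.1]) (by linarith [ht.2])
        rw [hs2] at this
        linarith
    rw [integral_add_mul_sq, hsum] at h
    linarith
  · have h := intervalIntegral.integral_mono_on (by norm_num) (hint.add hint')
      (hquad (2 * f 0) (f (-1) + f 1 - 2 * f 0)) fun t ht => by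
        rcases lt_trichotomy t 0 with h0 | rfl | h0
        · have := hf.add_neg_le (t := -t) (by linarith) (by linarith [ht.1])
          rw [neg_neg, neg_sq] at this
          linarith
        · norm_num
          linarith
        · have := hf.add_neg_le h0 (by linarith [ht.2])
          linarith
    rw [integral_add_mul_sq, hsum] at h
    linarith
end
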